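/- arXiv:2005.11166 — 5 statements merged into one kernel-verified Lean document; each statement's English description precedes it below -/
import Mathlib

section
/- The operator I¹ is diagonal-plus-first-row in the basis {e_N}: one has I¹e_0 = 0 μ-almost everywhere on ℤ_p, and for every N ≥ 1, (I¹e_N)(x) = p^{-N} e_N(x) − (p−1)^{1/2} p^{-N/2} e_0(x) for μ-almost every x ∈ ℤ_p. -/
open MeasureTheory Complex

noncomputable section

variable (p : ℕ) [Fact p.Prime] [MeasurableSpace ℚ_[p]] [BorelSpace ℚ_[p]]

/-- The radial eigenfunction `v_N` (for `N ≥ 1`): equal to `1` for `‖x‖ ≤ p^{-N}`,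
to `-1/(p-1)` for `‖x‖ = p^{-N+1}`, and to `0` for `‖x‖ ≥ p^{-N+2}`. -/
def vN (N : ℕ) (x : ℚ_[p]) : ℂ :=
  if ‖x‖ ≤ (p : ℝ) ^ (-(N : ℤ)) then 1
  else if ‖x‖ = (p : ℝ) ^ (1 - (N : ℤ)) then -1 / ((p : ℂ) - 1)
  else 0

/-- The orthonormal system `e_N`: `e_0 ≡ 1` and `e_N = (p-1)^{1/2} p^{N/2} v_N` for `N ≥ 1`. -/
def eN (N : ℕ) (x : ℚ_[p]) : ℂ :=
  if N = 0 then 1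
  else ((Real.sqrt ((p : ℝ) - 1) * (p : ℝ) ^ ((N : ℝ) / 2) : ℝ) : ℂ) * vN p N x

/-- The `p`-adic antiderivative `I¹`:
`(I¹u)(x) = p⁻¹‖x‖u(x) + ((1-p)/(p·log p)) ∫_{‖y‖<‖x‖} (log‖x‖ - log‖y‖) u(y) dμ(y)`
(its value at `x = 0` is `0`). -/
def I1 (μ : Measure ℚ_[p]) (u : ℚ_[p] → ℂ) (x : ℚ_[p]) : ℂ :=
  (((p : ℝ)⁻¹ * ‖x‖ : ℝ) : ℂ) * u x
    + (((1 - (p : ℝ)) / ((p : ℝ) * Real.log p) : ℝ) : ℂ) *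
      ∫ y in {y : ℚ_[p] | ‖y‖ < ‖x‖},
        ((Real.log ‖x‖ - Real.log ‖y‖ : ℝ) : ℂ) * u y ∂μ

/-- The closed ball of radius `p ^ (-n)` around `0` in `ℚ_[p]`. -/
def levelBall (n : ℕ) : Set ℚ_[p] := Metric.closedBall 0 ((p : ℝ) ^ (-(n : ℤ)))

section

omit [MeasurableSpace ℚ_[p]] [BorelSpace ℚ_[p]]

lemma mem_levelBall {n : ℕ} {y : ℚ_[p]} : y ∈ levelBall p n ↔ ‖y‖ ≤ (p : ℝ) ^ (-(n : ℤ)) := by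
  simp [levelBall]

lemma one_lt_cast_prime : 1 < (p : ℝ) := mod_cast (Fact.out : p.Prime).one_lt

lemma levelBall_antitone : Antitone (levelBall p) := by
  intro m n h
  refine Metric.closedBall_subset_closedBall ?_
  exact zpow_le_zpow_right₀ (one_lt_cast_prime p).le (by omega)

lemma norm_lt_zpow_neg_iff {k : ℕ} {y : ℚ_[p]} :
    ‖y‖ < (p : ℝ) ^ (-(k : ℤ)) ↔ y ∈ levelBall p (k + 1) := by
  rw [mem_levelBall, Padic.norm_lt_pow_iff_norm_le_pow_sub_one]
  push_cast
  rw [neg_add, sub_eq_add_neg]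

lemma mem_levelBall_sdiff_iff {k : ℕ} {y : ℚ_[p]} :
    y ∈ levelBall p k \ levelBall p (k + 1) ↔ ‖y‖ = (p : ℝ) ^ (-(k : ℤ)) := by
  rw [Set.mem_sdiff, ← norm_lt_zpow_neg_iff, mem_levelBall, not_lt, le_antisymm_iff]

/-- A nonzero `p`-adic integer has norm `p ^ (-k)` for some `k : ℕ`. -/
lemma exists_norm_eq_zpow_neg {x : ℚ_[p]} (hx0 : x ≠ 0) (hx : ‖x‖ ≤ 1) :
    ∃ k : ℕ, ‖x‖ = (p : ℝ) ^ (-(k : ℤ)) := by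
  refine ⟨x.valuation.toNat, ?_⟩
  rw [Int.toNat_of_nonneg ((Padic.norm_le_one_iff_val_nonneg x).1 hx)]
  exact Padic.norm_eq_zpow_neg_valuation hx0

/-- A ball splits into `p` translates of the next smaller ball. -/
lemma levelBall_eq_biUnion (n : ℕ) :
    levelBall p n = ⋃ a ∈ Finset.range p,
      Metric.closedBall ((a : ℚ_[p]) * (p : ℚ_[p]) ^ n) ((p : ℝ) ^ (-((n + 1 : ℕ) : ℤ))) := by
  have hp := one_lt_cast_prime p
  have hp0 : (p : ℚ_[p]) ≠ 0 := mod_cast (Fact.out : p.Prime).ne_zero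
  ext y
  simp only [mem_levelBall, Set.mem_iUnion, Finset.mem_range, exists_prop, Metric.mem_closedBall,
    dist_eq_norm]
  constructor
  · intro hy
    have hz : ‖y / (p : ℚ_[p]) ^ n‖ ≤ 1 := by
      rw [norm_div, norm_pow, Padic.norm_p, inv_pow, div_inv_eq_mul]
      rw [zpow_neg, zpow_natCast] at hy
      calc ‖y‖ * (p : ℝ) ^ n ≤ ((p : ℝ) ^ n)⁻¹ * (p : ℝ) ^ n := by gcongr
        _ = 1 := inv_mul_cancel₀ (by positivity)
    let z : ℤ_[p] := ⟨y / (p : ℚ_[p]) ^ n, hz⟩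
    refine ⟨z.zmodRepr, z.zmodRepr_lt_p, ?_⟩
    have h := z.norm_sub_zmodRepr_lt_one
    rw [PadicInt.norm_def] at h
    push_cast at h
    have h1 : ‖y / (p : ℚ_[p]) ^ n - (z.zmodRepr : ℚ_[p])‖ ≤ (p : ℝ) ^ (-1 : ℤ) := by
      rw [Padic.norm_le_pow_iff_norm_lt_pow_add_one]
      simpa using h
    have h2 : y - (z.zmodRepr : ℚ_[p]) * (p : ℚ_[p]) ^ n
        = (y / (p : ℚ_[p]) ^ n - (z.zmodRepr : ℚ_[p])) * (p : ℚ_[p]) ^ n := by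
      field_simp
    rw [h2, norm_mul, norm_pow, Padic.norm_p, zpow_neg, zpow_natCast, pow_succ', mul_inv, inv_pow]
    rw [zpow_neg_one] at h1
    gcongr
  · rintro ⟨a, -, ha⟩
    have h1 : ‖(a : ℚ_[p]) * (p : ℚ_[p]) ^ n‖ ≤ (p : ℝ) ^ (-(n : ℤ)) := by
      rw [norm_mul, norm_pow, Padic.norm_p, zpow_neg, zpow_natCast, inv_pow]
      have : ‖(a : ℚ_[p])‖ ≤ 1 := by simpa using Padic.norm_int_le_one (p := p) (a : ℤ)
      exact mul_le_of_le_one_left (by positivity) this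
    have h2 : ‖y - (a : ℚ_[p]) * (p : ℚ_[p]) ^ n‖ ≤ (p : ℝ) ^ (-(n : ℤ)) :=
      ha.trans (zpow_le_zpow_right₀ hp.le (by omega))
    have h3 := Padic.nonarchimedean (y - (a : ℚ_[p]) * (p : ℚ_[p]) ^ n) ((a : ℚ_[p]) * (p : ℚ_[p]) ^ n)
    rw [sub_add_cancel] at h3
    exact h3.trans (max_le h2 h1)

lemma pairwiseDisjoint_closedBall (n : ℕ) :
    Set.PairwiseDisjoint (Finset.range p : Set ℕ) fun a : ℕ ↦
      Metric.closedBall ((a : ℚ_[p]) * (p : ℚ_[p]) ^ n) ((p : ℝ) ^ (-((n + 1 : ℕ) : ℤ))) := by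
  have hp := one_lt_cast_prime p
  intro a ha b hb hab
  simp only [Finset.coe_range, Set.mem_Iio] at ha hb
  refine Set.disjoint_left.2 fun y hya hyb ↦ hab ?_
  simp only [Metric.mem_closedBall, dist_eq_norm] at hya hyb
  have h := Padic.nonarchimedean (y - (b : ℚ_[p]) * (p : ℚ_[p]) ^ n) (-(y - (a : ℚ_[p]) * (p : ℚ_[p]) ^ n))
  rw [norm_neg] at h
  have h1 := h.trans (max_le hyb hya)
  have h2 : y - (b : ℚ_[p]) * (p : ℚ_[p]) ^ n + -(y - (a : ℚ_[p]) * (p : ℚ_[p]) ^ n)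
      = (((a : ℤ) - (b : ℤ) : ℤ) : ℚ_[p]) * (p : ℚ_[p]) ^ n := by
    push_cast; ring
  rw [h2, norm_mul, norm_pow, Padic.norm_p, zpow_neg, zpow_natCast, pow_succ', mul_inv, inv_pow]
    at h1
  have h3 := le_of_mul_le_mul_right h1 (by positivity)
  have h4 : ‖(((a : ℤ) - (b : ℤ) : ℤ) : ℚ_[p])‖ < 1 := h3.trans_lt (inv_lt_one_of_one_lt₀ hp)
  rw [Padic.norm_intCast_lt_one_iff] at h4
  have h5 := Int.eq_zero_of_abs_lt_dvd h4 (by rw [abs_lt]; omega)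
  omega

lemma iUnion_levelBall_sdiff (M : ℕ) :
    ⋃ i : ℕ, levelBall p (M + i) \ levelBall p (M + i + 1) = levelBall p M \ {0} := by
  have hp := one_lt_cast_prime p
  ext y
  simp only [Set.mem_iUnion, mem_levelBall_sdiff_iff]
  rw [Set.mem_sdiff, Set.mem_singleton_iff, mem_levelBall]
  constructor
  · rintro ⟨i, hi⟩
    refine ⟨hi.trans_le (zpow_le_zpow_right₀ hp.le (by omega)), ?_⟩
    rintro rfl
    rw [norm_zero] at hi
    exact (zpow_pos (by positivity) _).ne hi
  · rintro ⟨hy, hy0⟩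
    obtain ⟨k, hk⟩ := exists_norm_eq_zpow_neg p hy0
      (hy.trans (zpow_le_one_of_nonpos₀ hp.le (by omega)))
    rw [hk, zpow_le_zpow_iff_right₀ hp] at hy
    refine ⟨k - M, ?_⟩
    rw [hk, Nat.add_sub_cancel' (by omega)]

lemma hasSum_log_sphere (M : ℕ) :
    HasSum (fun i : ℕ ↦ (((M + i : ℕ) : ℝ) * Real.log p) *
        ((p : ℝ)⁻¹ ^ (M + i) * (1 - (p : ℝ)⁻¹)))
      (Real.log p * (p : ℝ)⁻¹ ^ M * (M + 1 / ((p : ℝ) - 1))) := by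
  have hp := one_lt_cast_prime p
  have hr : ‖(p : ℝ)⁻¹‖ < 1 := by
    rw [norm_inv, Real.norm_natCast]
    exact inv_lt_one_of_one_lt₀ hp
  have h := (((hasSum_geometric_of_norm_lt_one hr).mul_left (M : ℝ)).add
    (hasSum_coe_mul_geometric_of_norm_lt_one hr)).mul_left
      (Real.log p * (p : ℝ)⁻¹ ^ M * (1 - (p : ℝ)⁻¹))
  convert! h using 1
  · ext i
    push_cast
    ring
  · have h1 : (p : ℝ) - 1 ≠ 0 := by linarith
    have h2 : (p : ℝ) ≠ 0 := by linarith
    have h3 : 1 - (p : ℝ)⁻¹ ≠ 0 := by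
      rw [← one_div, one_sub_div h2]
      exact div_ne_zero h1 h2
    have h4 : (M : ℝ) + 1 / ((p : ℝ) - 1)
        = (1 - (p : ℝ)⁻¹) * (M * (1 - (p : ℝ)⁻¹)⁻¹ + (p : ℝ)⁻¹ / (1 - (p : ℝ)⁻¹) ^ 2) := by
      field_simp
    rw [h4]
    ring

lemma vN_eq_indicator (n : ℕ) (y : ℚ_[p]) :
    vN p (n + 1) y = (p / ((p : ℂ) - 1)) * (levelBall p (n + 1)).indicator 1 y
      - (1 / ((p : ℂ) - 1)) * (levelBall p n).indicator 1 y := by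
  have h1 : (p : ℂ) - 1 ≠ 0 := by
    rw [sub_ne_zero]
    exact_mod_cast (Fact.out : p.Prime).one_lt.ne'
  have he : 1 - ((n + 1 : ℕ) : ℤ) = -(n : ℤ) := by push_cast; ring
  by_cases hy : y ∈ levelBall p (n + 1)
  · have hy' := levelBall_antitone p n.le_succ hy
    rw [vN, if_pos ((mem_levelBall p).1 hy), Set.indicator_of_mem hy, Set.indicator_of_mem hy']
    simp only [Pi.one_apply]
    field_simp
  · rw [vN, if_neg (mt (mem_levelBall p).2 hy), he, Set.indicator_of_notMem hy]
    by_cases hy' : y ∈ levelBall p n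
    · rw [if_pos ((mem_levelBall_sdiff_iff p).1 ⟨hy', hy⟩), Set.indicator_of_mem hy']
      simp [neg_div]
    · rw [if_neg fun h ↦ hy' ((mem_levelBall_sdiff_iff p).2 h).1, Set.indicator_of_notMem hy']
      simp

end

omit [BorelSpace ℚ_[p]] in
lemma I1_const_mul (μ : Measure ℚ_[p]) (c : ℂ) (u : ℚ_[p] → ℂ) (x : ℚ_[p]) :
    I1 p μ (fun y ↦ c * u y) x = c * I1 p μ u x := by
  simp only [I1, mul_left_comm _ c, integral_const_mul]
  ring

lemma measurableSet_levelBall (n : ℕ) : MeasurableSet (levelBall p n) :=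
  Metric.isClosed_closedBall.measurableSet

section

variable (μ : Measure ℚ_[p]) [μ.IsAddHaarMeasure]

lemma measure_levelBall_eq_mul (n : ℕ) :
    μ (levelBall p n) = p * μ (levelBall p (n + 1)) := by
  rw [levelBall_eq_biUnion, measure_biUnion_finset (pairwiseDisjoint_closedBall p n)
    fun _ _ ↦ Metric.isClosed_closedBall.measurableSet]
  have (a : ℚ_[p]) (s : ℝ) : μ (Metric.closedBall a s) = μ (Metric.closedBall 0 s) := by
    have : Metric.closedBall (0 : ℚ_[p]) s = (a + ·) ⁻¹' Metric.closedBall a s := by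
      simp [preimage_add_closedBall]
    rw [this, measure_preimage_add]
  simp [this, levelBall]

variable (hμ : μ {x : ℚ_[p] | ‖x‖ ≤ 1} = 1)
include hμ

lemma measureReal_levelBall (n : ℕ) : μ.real (levelBall p n) = (p : ℝ)⁻¹ ^ n := by
  have hp := one_lt_cast_prime p
  induction n with
  | zero =>
    have : levelBall p 0 = {x : ℚ_[p] | ‖x‖ ≤ 1} := by ext; simp [mem_levelBall]
    simp [measureReal_def, this, hμ]
  | succ n ih =>
    have h := congrArg ENNReal.toReal (measure_levelBall_eq_mul p μ n)
    rw [ENNReal.toReal_mul, ENNReal.toReal_natCast] at h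
    change μ.real _ = p * μ.real _ at h
    rw [ih] at h
    rw [pow_succ, h]
    field_simp

lemma measureReal_levelBall_sdiff (n : ℕ) :
    μ.real (levelBall p n \ levelBall p (n + 1)) = (p : ℝ)⁻¹ ^ n * (1 - (p : ℝ)⁻¹) := by
  rw [measureReal_sdiff (levelBall_antitone p n.le_succ) (measurableSet_levelBall p _)
    (isCompact_closedBall _ _).measure_lt_top.ne,
    measureReal_levelBall p μ hμ, measureReal_levelBall p μ hμ, Nat.succ_eq_add_one, pow_succ]
  ring

lemma integral_log_norm_levelBall (M : ℕ) :
    IntegrableOn (fun y ↦ Real.log ‖y‖) (levelBall p M) μ ∧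
    ∫ y in levelBall p M, Real.log ‖y‖ ∂μ
      = -(Real.log p * (p : ℝ)⁻¹ ^ M * (M + 1 / ((p : ℝ) - 1))) := by
  have hp := one_lt_cast_prime p
  have hlog : 0 < Real.log p := Real.log_pos hp
  let S : ℕ → Set ℚ_[p] := fun i ↦ levelBall p (M + i) \ levelBall p (M + i + 1)
  have hSm (i : ℕ) : MeasurableSet (S i) :=
    (measurableSet_levelBall p (M + i)).diff (measurableSet_levelBall p (M + i + 1))
  have hSfin (i : ℕ) : μ (S i) ≠ ⊤ :=
    ((measure_mono Set.sdiff_subset).trans_lt (isCompact_closedBall _ _).measure_lt_top).ne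
  have hS (i : ℕ) : Set.EqOn (fun y ↦ Real.log ‖y‖)
      (fun _ ↦ -(((M + i : ℕ) : ℝ) * Real.log p)) (S i) := by
    intro y hy
    simp only
    rw [(mem_levelBall_sdiff_iff p).1 hy, Real.log_zpow]
    push_cast
    ring
  have hd : Pairwise (Function.onFun Disjoint S) := by
    intro i j hij
    refine Set.disjoint_left.2 fun y hi hj ↦ hij ?_
    have h := ((mem_levelBall_sdiff_iff p).1 hi).symm.trans ((mem_levelBall_sdiff_iff p).1 hj)
    have := zpow_right_injective₀ (by positivity) hp.ne' h
    omega
  have hint (i : ℕ) : IntegrableOn (fun y ↦ Real.log ‖y‖) (S i) μ :=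
    (integrableOn_const (hSfin i)).congr_fun (hS i).symm (hSm i)
  have hsum : Summable fun i ↦ ∫ y in S i, ‖Real.log ‖y‖‖ ∂μ := by
    refine (hasSum_log_sphere p M).summable.congr fun i ↦ ?_
    rw [setIntegral_congr_fun (hSm i) fun y hy ↦ congrArg norm (hS i hy), setIntegral_const,
      measureReal_levelBall_sdiff p μ hμ, norm_neg, Real.norm_of_nonneg (by positivity),
      smul_eq_mul, mul_comm]
  have hI := integrableOn_iUnion_of_summable_integral_norm hint hsum
  have hval := hasSum_integral_iUnion hSm hd hI
  have hval' : HasSum (fun i ↦ ∫ y in S i, Real.log ‖y‖ ∂μ)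
      (-(Real.log p * (p : ℝ)⁻¹ ^ M * (M + 1 / ((p : ℝ) - 1)))) := by
    convert! (hasSum_log_sphere p M).neg using 1
    ext i
    rw [setIntegral_congr_fun (hSm i) (hS i), setIntegral_const,
      measureReal_levelBall_sdiff p μ hμ, smul_eq_mul]
    ring
  have hae : (levelBall p M \ {0} : Set ℚ_[p]) =ᵐ[μ] levelBall p M :=
    sdiff_null_ae_eq_self (measure_singleton 0)
  rw [← integrableOn_congr_set_ae hae, ← setIntegral_congr_set hae, ← iUnion_levelBall_sdiff]
  exact ⟨hI, hval.unique hval'⟩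

/-- The integral over a ball of the kernel of the antiderivative. -/
lemma integral_kernel_levelBall (k M : ℕ) :
    IntegrableOn (fun y ↦ ((-(k * Real.log p) - Real.log ‖y‖ : ℝ) : ℂ)) (levelBall p M) μ ∧
    ∫ y in levelBall p M, ((-(k * Real.log p) - Real.log ‖y‖ : ℝ) : ℂ) ∂μ
      = ((Real.log p * (p : ℝ)⁻¹ ^ M * (M - k + 1 / ((p : ℝ) - 1)) : ℝ) : ℂ) := by
  obtain ⟨hi, hv⟩ := integral_log_norm_levelBall p μ hμ M
  have hc : IntegrableOn (fun _ : ℚ_[p] ↦ -((k : ℝ) * Real.log p)) (levelBall p M) μ :=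
    integrableOn_const (isCompact_closedBall _ _).measure_lt_top.ne
  refine ⟨(hc.sub hi).ofReal, ?_⟩
  rw [integral_complex_ofReal, integral_sub hc hi, hv, setIntegral_const,
    measureReal_levelBall p μ hμ, smul_eq_mul]
  congr 1
  ring

omit [BorelSpace ℚ_[p]] [μ.IsAddHaarMeasure] hμ in
lemma I1_apply (u : ℚ_[p] → ℂ) {k : ℕ} {x : ℚ_[p]} (hx : ‖x‖ = (p : ℝ) ^ (-(k : ℤ))) :
    I1 p μ u x = (((p : ℝ)⁻¹ * (p : ℝ)⁻¹ ^ k : ℝ) : ℂ) * u x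
      + (((1 - (p : ℝ)) / ((p : ℝ) * Real.log p) : ℝ) : ℂ) *
        ∫ y in levelBall p (k + 1), ((-(k * Real.log p) - Real.log ‖y‖ : ℝ) : ℂ) * u y ∂μ := by
  have hs : {y : ℚ_[p] | ‖y‖ < ‖x‖} = levelBall p (k + 1) := by
    ext y
    rw [Set.mem_ofPred_eq, hx, norm_lt_zpow_neg_iff]
  have hl : Real.log ‖x‖ = -(k * Real.log p) := by
    rw [hx, Real.log_zpow]
    push_cast
    ring
  rw [I1, hs, hl, hx, zpow_neg, zpow_natCast, inv_pow]

/-- On functions equal to `1` on the open ball of radius `‖x‖`, the antiderivative is explicit. -/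
lemma I1_apply_of_eq_one {u : ℚ_[p] → ℂ} {k : ℕ} {x : ℚ_[p]}
    (hx : ‖x‖ = (p : ℝ) ^ (-(k : ℤ))) (hu : ∀ y ∈ levelBall p (k + 1), u y = 1) :
    I1 p μ u x = (((p : ℝ)⁻¹ ^ (k + 1) : ℝ) : ℂ) * (u x - 1) := by
  have hp := one_lt_cast_prime p
  have hlog : Real.log p ≠ 0 := (Real.log_pos hp).ne'
  have h1 : (p : ℝ) - 1 ≠ 0 := by linarith
  have h2 : (p : ℝ) ≠ 0 := by linarith
  rw [I1_apply p μ u hx, setIntegral_congr_fun (measurableSet_levelBall p _)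
    (g := fun y ↦ ((-(k * Real.log p) - Real.log ‖y‖ : ℝ) : ℂ))
    (fun y hy ↦ by simp only [hu y hy, mul_one]),
    (integral_kernel_levelBall p μ hμ k (k + 1)).2, ← ofReal_mul, ← pow_succ']
  have : (1 - (p : ℝ)) / ((p : ℝ) * Real.log p) * (Real.log p * (p : ℝ)⁻¹ ^ (k + 1) *
      (((k + 1 : ℕ) : ℝ) - k + 1 / ((p : ℝ) - 1))) = -(p : ℝ)⁻¹ ^ (k + 1) := by
    push_cast
    field_simp
    ring
  rw [this]
  push_cast
  ring

end

/-- The antiderivative of `v_N`, for `N = n + 1`. -/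
lemma I1_vN (μ : Measure ℚ_[p]) [μ.IsAddHaarMeasure] (hμ : μ {x : ℚ_[p] | ‖x‖ ≤ 1} = 1)
    (n : ℕ) {k : ℕ} {x : ℚ_[p]} (hx : ‖x‖ = (p : ℝ) ^ (-(k : ℤ))) :
    I1 p μ (vN p (n + 1)) x = (((p : ℝ)⁻¹ ^ (n + 1) : ℝ) : ℂ) * (vN p (n + 1) x - 1) := by
  have hp := one_lt_cast_prime p
  have hlog : Real.log p ≠ 0 := (Real.log_pos hp).ne'
  have h1 : (p : ℝ) - 1 ≠ 0 := by linarith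
  have h2 : (p : ℝ) ≠ 0 := by linarith
  rcases le_or_gt n k with hk | hk
  · have hu (y : ℚ_[p]) (hy : y ∈ levelBall p (k + 1)) : vN p (n + 1) y = 1 :=
      if_pos ((mem_levelBall p).1 (levelBall_antitone p (Nat.succ_le_succ hk) hy))
    rw [I1_apply_of_eq_one p μ hμ hx hu]
    rcases hk.eq_or_lt with rfl | hk
    · rfl
    · have : vN p (n + 1) x = 1 := if_pos (hx.trans_le (zpow_le_zpow_right₀ hp.le (by omega)))
      simp [this]
  · have hvx : vN p (n + 1) x = 0 := by
      have hn : x ∉ levelBall p n := by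
        rw [mem_levelBall, hx, zpow_le_zpow_iff_right₀ hp]
        omega
      rw [vN_eq_indicator, Set.indicator_of_notMem hn,
        Set.indicator_of_notMem fun h ↦ hn (levelBall_antitone p n.le_succ h)]
      ring
    let f : ℚ_[p] → ℂ := fun y ↦ ((-(k * Real.log p) - Real.log ‖y‖ : ℝ) : ℂ)
    have hfv (y : ℚ_[p]) : f y * vN p (n + 1) y
        = (p / ((p : ℂ) - 1)) * (levelBall p (n + 1)).indicator f y
          - (1 / ((p : ℂ) - 1)) * (levelBall p n).indicator f y := by
      classical
      rw [vN_eq_indicator]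
      simp only [Set.indicator_apply, Pi.one_apply]
      split_ifs <;> ring
    obtain ⟨hi, hv⟩ := integral_kernel_levelBall p μ hμ k (n + 1)
    obtain ⟨hi', hv'⟩ := integral_kernel_levelBall p μ hμ k n
    have hm := measurableSet_levelBall p (n + 1)
    have hm' := measurableSet_levelBall p n
    have hI : ∫ y in levelBall p (k + 1),
          ((-(k * Real.log p) - Real.log ‖y‖ : ℝ) : ℂ) * vN p (n + 1) y ∂μ
        = ∫ y in levelBall p (k + 1), ((p / ((p : ℂ) - 1)) * (levelBall p (n + 1)).indicator f y
          - (1 / ((p : ℂ) - 1)) * (levelBall p n).indicator f y) ∂μ :=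
      integral_congr_ae (.of_forall hfv)
    rw [I1_apply p μ _ hx, hvx, hI,
      integral_sub (((integrable_indicator_iff hm).2 hi).integrableOn.const_mul _)
        (((integrable_indicator_iff hm').2 hi').integrableOn.const_mul _),
      integral_const_mul, integral_const_mul, setIntegral_indicator hm, setIntegral_indicator hm',
      Set.inter_eq_right.2 (levelBall_antitone p (by omega)),
      Set.inter_eq_right.2 (levelBall_antitone p (by omega)), hv, hv']
    have : (1 - (p : ℝ)) / ((p : ℝ) * Real.log p) *
        (p / ((p : ℝ) - 1) * (Real.log p * (p : ℝ)⁻¹ ^ (n + 1) *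
          (((n + 1 : ℕ) : ℝ) - k + 1 / ((p : ℝ) - 1)))
        - 1 / ((p : ℝ) - 1) * (Real.log p * (p : ℝ)⁻¹ ^ n * ((n : ℝ) - k + 1 / ((p : ℝ) - 1))))
        = -(p : ℝ)⁻¹ ^ (n + 1) := by
      push_cast
      rw [pow_succ]
      field_simp
      ring
    have := congrArg (fun t : ℝ ↦ (t : ℂ)) this
    push_cast at this ⊢
    rw [this]
    ring

/-- In the basis `{e_N}`, the operator `I¹` is diagonal-plus-first-row:
`I¹e_0 = 0` a.e. on `ℤ_p` and, for `N ≥ 1`,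
`(I¹e_N)(x) = p^{-N} e_N(x) − (p−1)^{1/2} p^{-N/2} e_0(x)` for a.e. `x ∈ ℤ_p`. -/
theorem statement2
    (μ : Measure ℚ_[p]) [μ.IsAddHaarMeasure]
    (hμ : μ {x : ℚ_[p] | ‖x‖ ≤ 1} = 1) :
    (∀ᵐ x ∂(μ.restrict {x : ℚ_[p] | ‖x‖ ≤ 1}), I1 p μ (eN p 0) x = 0) ∧
    (∀ N : ℕ, 1 ≤ N →
      ∀ᵐ x ∂(μ.restrict {x : ℚ_[p] | ‖x‖ ≤ 1}),
        I1 p μ (eN p N) x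
          = (((p : ℝ) ^ (-(N : ℤ)) : ℝ) : ℂ) * eN p N x
            - ((Real.sqrt ((p : ℝ) - 1) * (p : ℝ) ^ (-(N : ℝ) / 2) : ℝ) : ℂ) * eN p 0 x) := by
  have hp := one_lt_cast_prime p
  have hball : MeasurableSet {x : ℚ_[p] | ‖x‖ ≤ 1} :=
    measurableSet_le measurable_norm measurable_const
  have hne : ∀ᵐ x ∂μ, x ≠ 0 := Measure.ae_ne μ 0
  refine ⟨?_, fun N hN ↦ ?_⟩
  · rw [ae_restrict_iff' hball]
    filter_upwards [hne] with x hx0 hx1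
    obtain ⟨k, hk⟩ := exists_norm_eq_zpow_neg p hx0 hx1
    have he (y : ℚ_[p]) : eN p 0 y = 1 := if_pos rfl
    rw [I1_apply_of_eq_one p μ hμ hk fun y _ ↦ he y, he]
    simp
  · obtain ⟨n, rfl⟩ := Nat.exists_eq_add_of_le' hN
    rw [ae_restrict_iff' hball]
    filter_upwards [hne] with x hx0 hx1
    obtain ⟨k, hk⟩ := exists_norm_eq_zpow_neg p hx0 hx1
    have he : eN p (n + 1) = fun y ↦ ((Real.sqrt ((p : ℝ) - 1) *
        (p : ℝ) ^ (((n + 1 : ℕ) : ℝ) / 2) : ℝ) : ℂ) * vN p (n + 1) y := by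
      ext y
      exact if_neg n.succ_ne_zero
    have hpow : (p : ℝ) ^ (-((n + 1 : ℕ) : ℝ) / 2)
        = (p : ℝ)⁻¹ ^ (n + 1) * (p : ℝ) ^ (((n + 1 : ℕ) : ℝ) / 2) := by
      rw [inv_pow, ← Real.rpow_natCast, ← Real.rpow_neg (by positivity),
        ← Real.rpow_add (by positivity)]
      congr 1
      ring
    have h0 : eN p 0 x = 1 := if_pos rfl
    rw [he, I1_const_mul, I1_vN p μ hμ n hk, h0, hpow, zpow_neg, zpow_natCast, inv_pow]
    push_cast
    ring
end
end

section
/- The basis {f_n} is a basis of triangular representation for Ĩ: for all integers n, j ≥ 0 and all x ∈ ℤ_p with ‖x‖ = p^{-j}, (Ĩ f_n)(x) = (1 − p^{-1})^{3/2} p^{-n/2} (j − n) if n > j, and (Ĩ f_n)(x) = 0 if n ≤ j. Consequently ⟨Ĩ f_n, f_j⟩_{L²(ℤ_p, μ)} = 0 whenever n ≤ j. -/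
open MeasureTheory Complex

noncomputable section

variable (p : ℕ) [Fact p.Prime] [MeasurableSpace ℚ_[p]] [BorelSpace ℚ_[p]]

/-- The Volterra operator `Ĩ`:
`(Ĩu)(x) = ((1-p)/(p·log p)) ∫_{‖y‖<‖x‖} (log‖x‖ - log‖y‖) u(y) dμ(y)`. -/
def Ivol (μ : Measure ℚ_[p]) (u : ℚ_[p] → ℂ) (x : ℚ_[p]) : ℂ :=
  (((1 - (p : ℝ)) / ((p : ℝ) * Real.log p) : ℝ) : ℂ) *
    ∫ y in {y : ℚ_[p] | ‖y‖ < ‖x‖},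
      ((Real.log ‖x‖ - Real.log ‖y‖ : ℝ) : ℂ) * u y ∂μ

/-- The orthonormal basis `f_n` of `ℋ`:
`f_n(x) = (1 − 1/p)^{-1/2} p^{n/2}` for `‖x‖ = p^{-n}` and `0` elsewhere. -/
def fBasis (n : ℕ) (x : ℚ_[p]) : ℂ :=
  if ‖x‖ = (p : ℝ) ^ (-(n : ℤ))
    then (((1 - (p : ℝ)⁻¹) ^ (-(1 : ℝ) / 2) * (p : ℝ) ^ ((n : ℝ) / 2) : ℝ) : ℂ)
    else 0

/-- The closed ball of radius `p ^ (-n)` is the union of `p` translates of the next smaller one. -/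
lemma padic_closedBall_eq_iUnion (p : ℕ) [Fact p.Prime] (n : ℕ) :
    {x : ℚ_[p] | ‖x‖ ≤ (p : ℝ) ^ (-(n : ℤ))} = ⋃ i ∈ Finset.range p,
      (fun x : ℚ_[p] => -((i : ℚ_[p]) * (p : ℚ_[p]) ^ n) + x) ⁻¹'
        {x : ℚ_[p] | ‖x‖ ≤ (p : ℝ) ^ (-((n + 1 : ℕ) : ℤ))} := by
  have hp0 : (0 : ℝ) < p := by exact_mod_cast (Fact.out : p.Prime).pos
  have hpn : (p : ℚ_[p]) ^ n ≠ 0 :=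
    pow_ne_zero _ (by exact_mod_cast (Fact.out : p.Prime).ne_zero)
  have hnorm : ‖(p : ℚ_[p]) ^ n‖ = (p : ℝ) ^ (-(n : ℤ)) := Padic.norm_p_pow n
  have hpos : (0 : ℝ) < (p : ℝ) ^ (-(n : ℤ)) := zpow_pos hp0 _
  ext x
  simp only [Set.mem_ofPred_eq, Set.mem_iUnion, Set.mem_preimage, Finset.mem_range, exists_prop]
  constructor
  · intro hx
    have hz : ‖x / (p : ℚ_[p]) ^ n‖ ≤ 1 := by
      rw [norm_div, hnorm]
      exact (div_le_one hpos).2 hx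
    obtain ⟨i, hi, hmem⟩ := PadicInt.exists_mem_range (p := p) ⟨x / (p : ℚ_[p]) ^ n, hz⟩
    refine ⟨i, hi, ?_⟩
    have h1 : ‖x / (p : ℚ_[p]) ^ n - i‖ < 1 := by
      exact PadicInt.mem_nonunits.1 hmem
    have h2 : -((i : ℚ_[p]) * (p : ℚ_[p]) ^ n) + x
        = (x / (p : ℚ_[p]) ^ n - i) * (p : ℚ_[p]) ^ n := by
      field_simp
      ring
    rw [Padic.norm_le_pow_iff_norm_lt_pow_add_one, h2, norm_mul, hnorm]
    have h3 : (-((n + 1 : ℕ) : ℤ) + 1) = -(n : ℤ) := by push_cast; ring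
    rw [h3]
    exact mul_lt_of_lt_one_left hpos h1
  · rintro ⟨i, -, hi⟩
    have h1 : ‖(i : ℚ_[p]) * (p : ℚ_[p]) ^ n‖ ≤ (p : ℝ) ^ (-(n : ℤ)) := by
      rw [norm_mul, hnorm]
      exact mul_le_of_le_one_left hpos.le (by simpa using Padic.norm_int_le_one (p := p) i)
    have h2 : (p : ℝ) ^ (-((n + 1 : ℕ) : ℤ)) ≤ (p : ℝ) ^ (-(n : ℤ)) :=
      zpow_le_zpow_right₀ (by exact_mod_cast (Fact.out : p.Prime).one_le) (by push_cast; linarith)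
    have h3 : x = (i : ℚ_[p]) * (p : ℚ_[p]) ^ n + (-((i : ℚ_[p]) * (p : ℚ_[p]) ^ n) + x) := by
      ring
    rw [h3]
    exact (Padic.nonarchimedean _ _).trans (max_le h1 (hi.trans h2))

lemma pairwiseDisjoint_padic_translates (p : ℕ) [Fact p.Prime] (n : ℕ) :
    ((Finset.range p : Finset ℕ) : Set ℕ).PairwiseDisjoint fun i : ℕ =>
      (fun x : ℚ_[p] => -((i : ℚ_[p]) * (p : ℚ_[p]) ^ n) + x) ⁻¹'
        {x : ℚ_[p] | ‖x‖ ≤ (p : ℝ) ^ (-((n + 1 : ℕ) : ℤ))} := by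
  have hp0 : (0 : ℝ) < p := by exact_mod_cast (Fact.out : p.Prime).pos
  have hnorm : ‖(p : ℚ_[p]) ^ n‖ = (p : ℝ) ^ (-(n : ℤ)) := Padic.norm_p_pow n
  have hpos : (0 : ℝ) < (p : ℝ) ^ (-(n : ℤ)) := zpow_pos hp0 _
  intro i hi j hj hij
  rw [Function.onFun, Set.disjoint_left]
  intro x hxi hxj
  simp only [Set.mem_ofPred_eq, Set.mem_preimage] at hxi hxj
  simp only [Finset.coe_range, Set.mem_Iio] at hi hj
  apply hij
  have h1 : ‖(((i : ℤ) - (j : ℤ) : ℤ) : ℚ_[p]) * (p : ℚ_[p]) ^ n‖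
      ≤ (p : ℝ) ^ (-((n + 1 : ℕ) : ℤ)) := by
    have h2 : (((i : ℤ) - (j : ℤ) : ℤ) : ℚ_[p]) * (p : ℚ_[p]) ^ n
        = (-((j : ℚ_[p]) * (p : ℚ_[p]) ^ n) + x) - (-((i : ℚ_[p]) * (p : ℚ_[p]) ^ n) + x) := by
      push_cast
      ring
    rw [h2, sub_eq_add_neg]
    exact (Padic.nonarchimedean _ _).trans (max_le hxj (by rwa [norm_neg]))
  have h3 : (-((n + 1 : ℕ) : ℤ) + 1) = -(n : ℤ) := by push_cast; ring
  rw [Padic.norm_le_pow_iff_norm_lt_pow_add_one, h3, norm_mul, hnorm,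
    mul_lt_iff_lt_one_left hpos, Padic.norm_intCast_lt_one_iff] at h1
  have h4 : (j : ℤ) ≡ i [ZMOD p] := Int.modEq_iff_dvd.2 h1
  exact (((Int.natCast_modEq_iff).1 h4).eq_of_lt_of_lt hj hi).symm

lemma measurableSet_padic_closedBall (r : ℝ) : MeasurableSet {x : ℚ_[p] | ‖x‖ ≤ r} :=
  measurableSet_le measurable_norm measurable_const

/-- Passing to the next larger ball multiplies the Haar measure by `p`. -/
lemma measure_padic_closedBall_eq_mul (μ : Measure ℚ_[p]) [μ.IsAddHaarMeasure] (n : ℕ) :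
    μ {x : ℚ_[p] | ‖x‖ ≤ (p : ℝ) ^ (-(n : ℤ))}
      = p * μ {x : ℚ_[p] | ‖x‖ ≤ (p : ℝ) ^ (-((n + 1 : ℕ) : ℤ))} := by
  rw [padic_closedBall_eq_iUnion, measure_biUnion_finset (pairwiseDisjoint_padic_translates p n)
    fun i _ => (measurable_const_add _) (measurableSet_padic_closedBall p _)]
  simp only [measure_preimage_add, Finset.sum_const, Finset.card_range, nsmul_eq_mul]

lemma measureReal_padic_closedBall (μ : Measure ℚ_[p]) [μ.IsAddHaarMeasure]
    (hμ : μ {x : ℚ_[p] | ‖x‖ ≤ 1} = 1) (n : ℕ) :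
    μ.real {x : ℚ_[p] | ‖x‖ ≤ (p : ℝ) ^ (-(n : ℤ))} = (p : ℝ) ^ (-(n : ℤ)) := by
  have hp0 : (p : ℝ) ≠ 0 := by exact_mod_cast (Fact.out : p.Prime).ne_zero
  induction n with
  | zero => simp [Measure.real, hμ]
  | succ n ih =>
    rw [Measure.real, measure_padic_closedBall_eq_mul, ENNReal.toReal_mul,
      ENNReal.toReal_natCast, ← Measure.real] at ih
    have h : (p : ℝ) ^ (-(n : ℤ)) = p * (p : ℝ) ^ (-((n + 1 : ℕ) : ℤ)) := by
      rw [← zpow_one_add₀ hp0]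
      congr 1
      push_cast
      ring
    exact mul_left_cancel₀ hp0 (ih.trans h)

lemma measureReal_padic_sphere (μ : Measure ℚ_[p]) [μ.IsAddHaarMeasure]
    (hμ : μ {x : ℚ_[p] | ‖x‖ ≤ 1} = 1) (n : ℕ) :
    μ.real {x : ℚ_[p] | ‖x‖ = (p : ℝ) ^ (-(n : ℤ))}
      = (1 - (p : ℝ)⁻¹) * (p : ℝ) ^ (-(n : ℤ)) := by
  have hp0 : (p : ℝ) ≠ 0 := by exact_mod_cast (Fact.out : p.Prime).ne_zero
  have h3 : (-((n + 1 : ℕ) : ℤ) + 1) = -(n : ℤ) := by push_cast; ring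
  have hset : {x : ℚ_[p] | ‖x‖ = (p : ℝ) ^ (-(n : ℤ))}
      = {x : ℚ_[p] | ‖x‖ ≤ (p : ℝ) ^ (-(n : ℤ))}
        \ {x : ℚ_[p] | ‖x‖ ≤ (p : ℝ) ^ (-((n + 1 : ℕ) : ℤ))} := by
    ext x
    simp only [Set.mem_ofPred_eq, Set.mem_sdiff]
    rw [Padic.norm_le_pow_iff_norm_lt_pow_add_one x (-((n + 1 : ℕ) : ℤ)), h3, not_lt]
    exact le_antisymm_iff
  have hsub : {x : ℚ_[p] | ‖x‖ ≤ (p : ℝ) ^ (-((n + 1 : ℕ) : ℤ))}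
      ⊆ {x : ℚ_[p] | ‖x‖ ≤ (p : ℝ) ^ (-(n : ℤ))} := by
    intro x hx
    rw [Set.mem_ofPred_eq, Padic.norm_le_pow_iff_norm_lt_pow_add_one, h3] at hx
    exact hx.le
  have hfin : μ {x : ℚ_[p] | ‖x‖ ≤ (p : ℝ) ^ (-(n : ℤ))} ≠ ⊤ := by
    intro h
    have h0 := measureReal_padic_closedBall p μ hμ n
    rw [Measure.real, h, ENNReal.toReal_top] at h0
    exact zpow_ne_zero _ hp0 h0.symm
  rw [hset, measureReal_sdiff hsub (measurableSet_padic_closedBall p _) hfin,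
    measureReal_padic_closedBall p μ hμ, measureReal_padic_closedBall p μ hμ, ← h3,
    zpow_add_one₀ hp0]
  field_simp

omit [BorelSpace ℚ_[p]] in
lemma Ivol_fBasis_of_le (μ : Measure ℚ_[p]) {n j : ℕ} (hnj : n ≤ j) {x : ℚ_[p]}
    (hx : ‖x‖ = (p : ℝ) ^ (-(j : ℤ))) : Ivol p μ (fBasis p n) x = 0 := by
  have hp1 : (1 : ℝ) ≤ p := by exact_mod_cast (Fact.out : p.Prime).one_le
  have hle : (p : ℝ) ^ (-(j : ℤ)) ≤ (p : ℝ) ^ (-(n : ℤ)) :=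
    zpow_le_zpow_right₀ hp1 (by lia)
  rw [Ivol, setIntegral_eq_zero_of_forall_eq_zero, mul_zero]
  intro y hy
  rw [Set.mem_ofPred_eq, hx] at hy
  rw [fBasis, if_neg (hy.trans_le hle).ne, mul_zero]

lemma Ivol_fBasis_of_lt (μ : Measure ℚ_[p]) [μ.IsAddHaarMeasure]
    (hμ : μ {x : ℚ_[p] | ‖x‖ ≤ 1} = 1) {n j : ℕ} (hjn : j < n) {x : ℚ_[p]}
    (hx : ‖x‖ = (p : ℝ) ^ (-(j : ℤ))) :
    Ivol p μ (fBasis p n) x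
      = (((1 - (p : ℝ)⁻¹) ^ ((3 : ℝ) / 2) * (p : ℝ) ^ (-(n : ℝ) / 2)
          * ((j : ℝ) - (n : ℝ)) : ℝ) : ℂ) := by
  have hp1 : (1 : ℝ) < p := by exact_mod_cast (Fact.out : p.Prime).one_lt
  have hp0 : (0 : ℝ) < p := one_pos.trans hp1
  have hlt : (p : ℝ) ^ (-(n : ℤ)) < (p : ℝ) ^ (-(j : ℤ)) :=
    zpow_lt_zpow_right₀ hp1 (by lia)
  have hlog : Real.log p ≠ 0 := (Real.log_pos hp1).ne'
  have hq : 0 < 1 - (p : ℝ)⁻¹ := sub_pos.2 (inv_lt_one_of_one_lt₀ hp1)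
  set c : ℝ := (1 - (p : ℝ)⁻¹) ^ (-(1 : ℝ) / 2) * (p : ℝ) ^ ((n : ℝ) / 2) with hc
  set S : Set ℚ_[p] := {y : ℚ_[p] | ‖y‖ = (p : ℝ) ^ (-(n : ℤ))} with hS
  have hSm : MeasurableSet S := measurableSet_eq_fun measurable_norm measurable_const
  have hSsub : S ⊆ {y : ℚ_[p] | ‖y‖ < ‖x‖} := by
    intro y hy
    rw [hS, Set.mem_ofPred_eq] at hy
    rw [Set.mem_ofPred_eq, hy, hx]
    exact hlt
  have hintegrand : (fun y : ℚ_[p] => ((Real.log ‖x‖ - Real.log ‖y‖ : ℝ) : ℂ) * fBasis p n y)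
      = S.indicator fun _ => ((((n : ℝ) - j) * Real.log p * c : ℝ) : ℂ) := by
    funext y
    by_cases hy : y ∈ S
    · rw [Set.indicator_of_mem hy]
      rw [hS, Set.mem_ofPred_eq] at hy
      rw [fBasis, if_pos hy, ← ofReal_mul, hx, hy, Real.log_zpow, Real.log_zpow]
      congr 1
      push_cast
      ring
    · rw [Set.indicator_of_notMem hy, fBasis, if_neg (show ¬‖y‖ = _ from hy), mul_zero]
  rw [Ivol, hintegrand, setIntegral_indicator hSm, Set.inter_eq_right.2 hSsub, setIntegral_const,
    hS, measureReal_padic_sphere p μ hμ n, real_smul, ← ofReal_mul, ← ofReal_mul]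
  congr 1
  have h1 : (1 - (p : ℝ)⁻¹) ^ ((3 : ℝ) / 2)
      = (1 - (p : ℝ)⁻¹) ^ 2 * (1 - (p : ℝ)⁻¹) ^ (-(1 : ℝ) / 2) := by
    rw [← Real.rpow_natCast, ← Real.rpow_add hq]
    norm_num
  have h2 : (p : ℝ) ^ (-(n : ℝ) / 2) = (p : ℝ) ^ (-(n : ℤ)) * (p : ℝ) ^ ((n : ℝ) / 2) := by
    rw [← Real.rpow_intCast, ← Real.rpow_add hp0]
    congr 1
    push_cast
    ring
  have h3 : (1 - (p : ℝ)) / (p * Real.log p) = -(1 - (p : ℝ)⁻¹) / Real.log p := by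
    field_simp
    ring
  rw [h1, h2, h3, hc]
  field_simp
  ring

/-- `{f_n}` is a basis of triangular representation for `Ĩ`: for
`‖x‖ = p^{-j}`, `(Ĩf_n)(x) = (1 − p^{-1})^{3/2} p^{-n/2}(j − n)` if `n > j` and `= 0` if
`n ≤ j`; consequently `⟨Ĩf_n, f_j⟩ = 0` whenever `n ≤ j`. -/
theorem statement10
    (μ : Measure ℚ_[p]) [μ.IsAddHaarMeasure]
    (hμ : μ {x : ℚ_[p] | ‖x‖ ≤ 1} = 1) :
    (∀ n j : ℕ, ∀ x : ℚ_[p], ‖x‖ = (p : ℝ) ^ (-(j : ℤ)) →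
      Ivol p μ (fBasis p n) x
        = if j < n
            then (((1 - (p : ℝ)⁻¹) ^ ((3 : ℝ) / 2) * (p : ℝ) ^ (-(n : ℝ) / 2)
                    * ((j : ℝ) - (n : ℝ)) : ℝ) : ℂ)
            else 0) ∧
    (∀ n j : ℕ, n ≤ j →
      ∫ x in {x : ℚ_[p] | ‖x‖ ≤ 1},
        Ivol p μ (fBasis p n) x * (starRingEnd ℂ) (fBasis p j x) ∂μ = 0) := by
  refine ⟨fun n j x hx => ?_, fun n j hnj => ?_⟩
  · split_ifs with h
    · exact Ivol_fBasis_of_lt p μ hμ h hx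
    · exact Ivol_fBasis_of_le p μ (not_lt.1 h) hx
  · refine setIntegral_eq_zero_of_forall_eq_zero fun x _ => ?_
    by_cases hx : ‖x‖ = (p : ℝ) ^ (-(j : ℤ))
    · rw [Ivol_fBasis_of_le p μ hnj hx, zero_mul]
    · rw [fBasis.eq_def p j, if_neg hx, map_zero, mul_zero]
end
end

section
/- For every integer m ≥ 0 and every x ∈ ℚ_p, x ≠ 0, ∫_{‖y‖ < ‖x‖} (log‖x‖ − log‖y‖) ‖y‖^m dμ(y) = d_m ‖x‖^{m+1}, where d_m = (1 − p^{-1}) (log p) p^{-(m+1)} (1 − p^{-(m+1)})^{-2}. In particular 0 < d_m ≤ A p^{-m} for a constant A > 0 depending only on p. -/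
open MeasureTheory Complex

noncomputable section

variable (p : ℕ) [Fact p.Prime] [MeasurableSpace ℚ_[p]] [BorelSpace ℚ_[p]]

/-- The constant `d_m = (1 − p^{-1})(log p) p^{-(m+1)} (1 − p^{-(m+1)})^{-2}`. -/
def dCoef (m : ℕ) : ℝ :=
  (1 - (p : ℝ)⁻¹) * Real.log p * (p : ℝ) ^ (-((m : ℤ) + 1)) *
    ((1 - (p : ℝ) ^ (-((m : ℤ) + 1)))⁻¹) ^ 2

lemma closedBall_norm_eq_biUnion_ball {q : ℕ} [Fact q.Prime] {x : ℚ_[q]} (hx : x ≠ 0) :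
    Metric.closedBall (0 : ℚ_[q]) ‖x‖ =
      ⋃ i ∈ Finset.range q, Metric.ball ((i : ℚ_[q]) * x) ‖x‖ := by
  have hx' : 0 < ‖x‖ := norm_pos_iff.2 hx
  ext y
  simp only [mem_closedBall_zero_iff, Set.mem_iUnion, mem_ball_iff_norm, Finset.mem_range,
    exists_prop]
  constructor
  · intro hy
    have hz : ‖y / x‖ ≤ 1 := by rw [norm_div]; exact (div_le_one hx').2 hy
    obtain ⟨z, hzx⟩ : ∃ z : ℤ_[q], (z : ℚ_[q]) = y / x := ⟨⟨y / x, hz⟩, rfl⟩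
    obtain ⟨n, hn, hmem⟩ := PadicInt.exists_mem_range z
    refine ⟨n, hn, ?_⟩
    rw [PadicInt.maximalIdeal_eq_span_p, Ideal.mem_span_singleton,
      ← PadicInt.norm_lt_one_iff_dvd, PadicInt.norm_def,
      PadicInt.coe_sub, PadicInt.coe_natCast, hzx] at hmem
    have h : y - n * x = (y / x - n) * x := by field_simp
    rw [h, norm_mul]
    exact (mul_lt_iff_lt_one_left hx').2 hmem
  · rintro ⟨n, -, hn⟩
    have hnx : ‖(n : ℚ_[q]) * x‖ ≤ ‖x‖ := by
      rw [norm_mul]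
      exact mul_le_of_le_one_left hx'.le (by exact_mod_cast Padic.norm_int_le_one (p := q) n)
    have h := Padic.nonarchimedean (y - (n : ℚ_[q]) * x) (n * x)
    rw [sub_add_cancel] at h
    exact h.trans (max_le hn.le hnx)

lemma pairwiseDisjoint_ball_natCast_mul {q : ℕ} [Fact q.Prime] (x : ℚ_[q]) :
    (Finset.range q : Set ℕ).PairwiseDisjoint
      fun i ↦ Metric.ball ((i : ℚ_[q]) * x) ‖x‖ := by
  intro i hi j hj hij
  refine Set.disjoint_left.2 fun y hyi hyj ↦ hij ?_
  simp only [Metric.mem_ball, dist_eq_norm] at hyi hyj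
  have hx' : 0 < ‖x‖ := (norm_nonneg _).trans_lt hyi
  have h := Padic.nonarchimedean (y - (j : ℚ_[q]) * x) (-(y - (i : ℚ_[q]) * x))
  rw [norm_neg] at h
  have h' : ‖(((i : ℤ) - (j : ℤ) : ℤ) : ℚ_[q])‖ < 1 := by
    refine (mul_lt_iff_lt_one_left hx').1 ?_
    rw [← norm_mul]
    refine lt_of_eq_of_lt ?_ (h.trans_lt (max_lt hyj hyi))
    push_cast
    ring_nf
  rw [Padic.norm_intCast_lt_one_iff] at h'
  simp only [Finset.coe_range, Set.mem_Iio] at hi hj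
  have := Int.eq_zero_of_abs_lt_dvd h' (by rw [abs_lt]; omega)
  omega

section

variable {p} (μ : Measure ℚ_[p]) [μ.IsAddHaarMeasure]

lemma measureReal_closedBall_norm {x : ℚ_[p]} (hx : x ≠ 0) :
    μ.real (Metric.closedBall 0 ‖x‖) = p * μ.real (Metric.ball 0 ‖x‖) := by
  rw [closedBall_norm_eq_biUnion_ball hx,
    measureReal_biUnion_finset (pairwiseDisjoint_ball_natCast_mul x)
      (fun _ _ ↦ measurableSet_ball)]
  simp [measureReal_def, Measure.addHaar_ball_center]

lemma measureReal_closedBall_zpow (hμ : μ {x : ℚ_[p] | ‖x‖ ≤ 1} = 1) (n : ℤ) :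
    μ.real (Metric.closedBall 0 ((p : ℝ) ^ n)) = (p : ℝ) ^ n := by
  have hp0 : (p : ℝ) ≠ 0 := mod_cast (Fact.out : p.Prime).ne_zero
  have hpp : (p : ℚ_[p]) ≠ 0 := mod_cast (Fact.out : p.Prime).ne_zero
  have step (n : ℤ) : μ.real (Metric.closedBall 0 ((p : ℝ) ^ (n + 1))) =
      p * μ.real (Metric.closedBall 0 ((p : ℝ) ^ n)) := by
    have h := measureReal_closedBall_norm μ (zpow_ne_zero (-(n + 1)) hpp)
    rw [Padic.norm_p_zpow, neg_neg] at h
    rw [h]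
    congr 2
    ext y
    simp [Padic.norm_le_pow_iff_norm_lt_pow_add_one]
  have h0 : μ.real (Metric.closedBall 0 1) = 1 := by
    have : Metric.closedBall (0 : ℚ_[p]) 1 = {x | ‖x‖ ≤ 1} := by ext; simp
    rw [measureReal_def, this, hμ, ENNReal.toReal_one]
  induction n with
  | zero => simpa using h0
  | succ k ih => rw [step, ih, zpow_add_one₀ hp0, mul_comm]
  | pred k ih =>
    have h := step (-(k : ℤ) - 1)
    rw [sub_add_cancel, ih] at h
    exact mul_left_cancel₀ hp0 (by rw [← h, mul_comm, ← zpow_add_one₀ hp0, sub_add_cancel])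

lemma measureReal_sphere_zpow (hμ : μ {x : ℚ_[p] | ‖x‖ ≤ 1} = 1) (n : ℤ) :
    μ.real (Metric.sphere 0 ((p : ℝ) ^ n)) = (1 - (p : ℝ)⁻¹) * (p : ℝ) ^ n := by
  have hp0 : (p : ℝ) ≠ 0 := mod_cast (Fact.out : p.Prime).ne_zero
  have hball : Metric.ball (0 : ℚ_[p]) ((p : ℝ) ^ n) =
      Metric.closedBall 0 ((p : ℝ) ^ (n - 1)) := by
    ext y
    simp [Padic.norm_lt_pow_iff_norm_le_pow_sub_one]
  rw [← Metric.closedBall_sdiff_ball,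
    measureReal_sdiff Metric.ball_subset_closedBall measurableSet_ball
      measure_closedBall_lt_top.ne, hball,
    measureReal_closedBall_zpow μ hμ, measureReal_closedBall_zpow μ hμ, zpow_sub_one₀ hp0]
  ring

/-- A radial function on an open ball is integrated by summing over the spheres. -/
lemma setIntegral_radial_eq_of_hasSum (hμ : μ {x : ℚ_[p] | ‖x‖ ≤ 1} = 1) (N : ℤ) (g : ℝ → ℝ)
    (hg : ∀ k : ℕ, 0 ≤ g ((p : ℝ) ^ (N - 1 - k))) {S : ℝ}
    (hS : HasSum (fun k : ℕ ↦
      (1 - (p : ℝ)⁻¹) * (p : ℝ) ^ (N - 1 - k) * g ((p : ℝ) ^ (N - 1 - k))) S) :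
    ∫ y in {y : ℚ_[p] | ‖y‖ < (p : ℝ) ^ N}, g ‖y‖ ∂μ = S := by
  have hp1 : 1 < (p : ℝ) := mod_cast (Fact.out : p.Prime).one_lt
  set F : ℕ → ℚ_[p] → ℝ := fun k ↦
    (Metric.sphere (0 : ℚ_[p]) ((p : ℝ) ^ (N - 1 - k))).indicator
      fun _ ↦ g ((p : ℝ) ^ (N - 1 - k)) with hF
  have hmeas (r : ℝ) : MeasurableSet (Metric.sphere (0 : ℚ_[p]) r) :=
    Metric.isClosed_sphere.measurableSet
  have hint (k : ℕ) : ∫ y, F k y ∂μ =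
      (1 - (p : ℝ)⁻¹) * (p : ℝ) ^ (N - 1 - k) * g ((p : ℝ) ^ (N - 1 - k)) := by
    rw [hF]
    simp only
    rw [integral_indicator_const _ (hmeas _), measureReal_sphere_zpow μ hμ, smul_eq_mul]
  have hnn (k : ℕ) (y : ℚ_[p]) : ‖F k y‖ = F k y :=
    Real.norm_of_nonneg (Set.indicator_nonneg (fun _ _ ↦ hg k) y)
  have hInt (k : ℕ) : Integrable (F k) μ :=
    (integrable_indicator_iff (hmeas _)).2
      (integrableOn_const ((isCompact_sphere _ _).measure_lt_top.ne))
  have hsum := hasSum_integral_of_summable_integral_norm hInt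
    (by simpa only [hnn, hint] using hS.summable)
  simp only [hint] at hsum
  rw [hS.unique hsum, ← integral_indicator (measurableSet_lt measurable_norm measurable_const)]
  refine integral_congr_ae ?_
  filter_upwards [Measure.ae_ne μ (0 : ℚ_[p])] with y hy
  obtain ⟨n, hn⟩ : ∃ n : ℤ, ‖y‖ = (p : ℝ) ^ n := ⟨_, Padic.norm_eq_zpow_neg_valuation hy⟩
  have hmem (k : ℕ) : y ∈ Metric.sphere (0 : ℚ_[p]) ((p : ℝ) ^ (N - 1 - k)) ↔ n = N - 1 - k := by
    rw [mem_sphere_zero_iff_norm, hn]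
    exact (zpow_right_injective₀ (by positivity) hp1.ne').eq_iff
  by_cases hlt : n < N
  · rw [Set.indicator_of_mem (by simpa [hn] using zpow_lt_zpow_right₀ hp1 hlt)]
    obtain ⟨k, hk⟩ := Int.eq_ofNat_of_zero_le (show 0 ≤ N - 1 - n by omega)
    have hnk : n = N - 1 - k := by omega
    rw [tsum_eq_single k]
    · simp only [hF]
      rw [Set.indicator_of_mem ((hmem k).2 hnk), hn, hnk]
    · intro j hj
      exact Set.indicator_of_notMem (fun h ↦ hj (by have := (hmem j).1 h; omega)) _
  · rw [Set.indicator_of_notMem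
      (by simpa [hn] using zpow_le_zpow_right₀ hp1.le (not_lt.1 hlt))]
    have h0 (k : ℕ) : F k y = 0 :=
      Set.indicator_of_notMem (fun h ↦ hlt (by have := (hmem k).1 h; omega)) _
    simp [h0]

end

lemma hasSum_dCoef {q : ℕ} [Fact q.Prime] (m : ℕ) (N : ℤ) :
    HasSum (fun k : ℕ ↦ (1 - (q : ℝ)⁻¹) * (q : ℝ) ^ (N - 1 - k) *
      ((Real.log ((q : ℝ) ^ N) - Real.log ((q : ℝ) ^ (N - 1 - k))) *
        ((q : ℝ) ^ (N - 1 - k)) ^ m)) (dCoef q m * ((q : ℝ) ^ N) ^ (m + 1)) := by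
  have hp1 : 1 < (q : ℝ) := mod_cast (Fact.out : q.Prime).one_lt
  have hp0 : (q : ℝ) ≠ 0 := by positivity
  set r : ℝ := (q : ℝ) ^ (-((m : ℤ) + 1)) with hr
  have hr0 : 0 < r := by positivity
  have hr1 : r < 1 := zpow_lt_one_of_neg₀ hp1 (by omega)
  have h := hasSum_coe_mul_geometric_of_norm_lt_one
    (show ‖r‖ < 1 by rwa [Real.norm_of_nonneg hr0.le])
  rw [← hasSum_nat_add_iff' 1] at h
  simp only [Finset.range_one, Finset.sum_singleton, Nat.cast_zero, zero_mul, sub_zero] at h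
  convert! h.mul_left ((1 - (q : ℝ)⁻¹) * Real.log q * ((q : ℝ) ^ N) ^ (m + 1)) using 1
  · ext k
    have hpow : (q : ℝ) ^ (N - 1 - k) * ((q : ℝ) ^ (N - 1 - k)) ^ m =
        ((q : ℝ) ^ N) ^ (m + 1) * r ^ (k + 1) := by
      rw [← pow_succ', hr, ← zpow_natCast, ← zpow_natCast, ← zpow_natCast, ← zpow_mul, ← zpow_mul,
        ← zpow_mul, ← zpow_add₀ hp0]
      congr 1
      push_cast
      ring
    rw [Real.log_zpow, Real.log_zpow]
    push_cast
    linear_combination (1 - (q : ℝ)⁻¹) * (k + 1) * Real.log q * hpow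
  · rw [dCoef, ← hr]
    field_simp

lemma dCoef_pos (q : ℕ) [Fact q.Prime] (m : ℕ) : 0 < dCoef q m := by
  have hp1 : 1 < (q : ℝ) := mod_cast (Fact.out : q.Prime).one_lt
  have h1 : 0 < 1 - (q : ℝ)⁻¹ := sub_pos.2 (inv_lt_one_of_one_lt₀ hp1)
  have h2 : 0 < 1 - (q : ℝ) ^ (-((m : ℤ) + 1)) :=
    sub_pos.2 (zpow_lt_one_of_neg₀ hp1 (by omega))
  have h3 := Real.log_pos hp1
  unfold dCoef
  positivity

lemma dCoef_le (q : ℕ) [Fact q.Prime] (m : ℕ) : dCoef q m ≤ dCoef q 0 * (q : ℝ) ^ (-(m : ℤ)) := by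
  have hp1 : 1 < (q : ℝ) := mod_cast (Fact.out : q.Prime).one_lt
  have h1 : 0 < 1 - (q : ℝ)⁻¹ := sub_pos.2 (inv_lt_one_of_one_lt₀ hp1)
  have h3 := Real.log_pos hp1
  have hle : (q : ℝ) ^ (-((m : ℤ) + 1)) ≤ (q : ℝ)⁻¹ := by
    rw [← zpow_neg_one]
    exact zpow_le_zpow_right₀ hp1.le (by omega)
  have hinv : (1 - (q : ℝ) ^ (-((m : ℤ) + 1)))⁻¹ ≤ (1 - (q : ℝ)⁻¹)⁻¹ := by gcongr
  have h2 : 0 ≤ (1 - (q : ℝ) ^ (-((m : ℤ) + 1)))⁻¹ := inv_nonneg.2 (by linarith)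
  calc dCoef q m ≤ (1 - (q : ℝ)⁻¹) * Real.log q * (q : ℝ) ^ (-((m : ℤ) + 1)) *
        ((1 - (q : ℝ)⁻¹)⁻¹) ^ 2 := by unfold dCoef; gcongr
    _ = dCoef q 0 * (q : ℝ) ^ (-(m : ℤ)) := by
      have : (q : ℝ) ^ (-((m : ℤ) + 1)) = (q : ℝ)⁻¹ * (q : ℝ) ^ (-(m : ℤ)) := by
        rw [← zpow_neg_one, ← zpow_add₀ (by positivity)]
        congr 1
        ring
      rw [this, dCoef]
      simp
      ring

/-- For every `m ≥ 0` and `x ≠ 0`,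
`∫_{‖y‖<‖x‖} (log‖x‖ − log‖y‖)‖y‖^m dμ(y) = d_m ‖x‖^{m+1}`, and `0 < d_m ≤ A p^{-m}`
for a constant `A > 0` depending only on `p`. -/
theorem statement11
    (μ : Measure ℚ_[p]) [μ.IsAddHaarMeasure]
    (hμ : μ {x : ℚ_[p] | ‖x‖ ≤ 1} = 1) :
    (∀ m : ℕ, ∀ x : ℚ_[p], x ≠ 0 →
      ∫ y in {y : ℚ_[p] | ‖y‖ < ‖x‖},
          (Real.log ‖x‖ - Real.log ‖y‖) * ‖y‖ ^ m ∂μ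
        = dCoef p m * ‖x‖ ^ (m + 1)) ∧
    (∃ A : ℝ, 0 < A ∧ ∀ m : ℕ,
      0 < dCoef p m ∧ dCoef p m ≤ A * (p : ℝ) ^ (-(m : ℤ))) := by
  refine ⟨fun m x hx ↦ ?_, dCoef p 0, dCoef_pos p 0, fun m ↦ ⟨dCoef_pos p m, dCoef_le p m⟩⟩
  have hp1 : 1 < (p : ℝ) := mod_cast (Fact.out : p.Prime).one_lt
  rw [Padic.norm_eq_zpow_neg_valuation hx]
  set N : ℤ := -x.valuation
  refine setIntegral_radial_eq_of_hasSum μ hμ N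
    (fun t ↦ (Real.log ((p : ℝ) ^ N) - Real.log t) * t ^ m) (fun k ↦ ?_) (hasSum_dCoef m N)
  refine mul_nonneg (sub_nonneg.2 (Real.log_le_log (by positivity) ?_)) (by positivity)
  exact zpow_le_zpow_right₀ hp1.le (by omega)
end
end

section
/- Uniqueness theorem for the Laplace-type transform: if φ̃(ξ) = 0 for all ξ ∈ ℚ_p, ξ ≠ 0, then φ is constant, i.e., ψ(k) = ψ(0) for all k ∈ ℤ (so φ(x) is the same constant for all x ≠ 0). -/
open MeasureTheory Complex

noncomputable section

variable (p : ℕ) [Fact p.Prime] [MeasurableSpace ℚ_[p]] [BorelSpace ℚ_[p]]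

/-- The radial function `v_0`: equal to `1` for `‖z‖ ≤ 1`, to `−1/(p−1)` for `‖z‖ = p`,
and to `0` for `‖z‖ ≥ p²`. -/
def v0 (z : ℚ_[p]) : ℂ :=
  if ‖z‖ ≤ 1 then 1
  else if ‖z‖ = (p : ℝ) then -1 / ((p : ℂ) - 1)
  else 0

/-- The Laplace-type transform `φ̃(ξ) = ∫_{ℚ_p} v_0(xξ) φ(x) dμ(x)`. -/
def laplace (μ : Measure ℚ_[p]) (φ : ℚ_[p] → ℂ) (ξ : ℚ_[p]) : ℂ :=
  ∫ x, v0 p (x * ξ) * φ x ∂μ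

/-- `Φ(n)`: the value of the Laplace-type transform at any `ξ` with `‖ξ‖ = pⁿ`
(here taken at `ξ = p^{-n}`, which has norm `pⁿ`). -/
def Phi (μ : Measure ℚ_[p]) (φ : ℚ_[p] → ℂ) (n : ℤ) : ℂ :=
  laplace p μ φ ((p : ℚ_[p]) ^ (-n))

namespace PadicLaplace

section Balls

variable {p : ℕ} [Fact p.Prime]

lemma cast_prime_pos : (0 : ℝ) < p := by exact_mod_cast (Fact.out : p.Prime).pos

lemma one_lt_cast_prime : (1 : ℝ) < p := by exact_mod_cast (Fact.out : p.Prime).one_lt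

lemma norm_prime_zpow_mul (x : ℚ_[p]) (k : ℤ) :
    ‖(p : ℚ_[p]) ^ k * x‖ = (p : ℝ) ^ (-k) * ‖x‖ := by
  rw [norm_mul, Padic.norm_p_zpow]

/-- A closed ball is the union of `p` translates of the next smaller one. -/
lemma closedBall_zpow_eq_iUnion (k : ℤ) :
    Metric.closedBall (0 : ℚ_[p]) ((p : ℝ) ^ (k + 1)) =
      ⋃ i : Fin p, Metric.closedBall ((p : ℚ_[p]) ^ (-(k + 1)) * (i : ℕ)) ((p : ℝ) ^ k) := by
  have hp : (0 : ℝ) < p := cast_prime_pos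
  have hp' : (p : ℚ_[p]) ≠ 0 := by exact_mod_cast (Fact.out : p.Prime).ne_zero
  ext x
  simp only [mem_closedBall_iff_norm, sub_zero, Set.mem_iUnion]
  constructor
  · intro hx
    have hy : ‖(p : ℚ_[p]) ^ (k + 1) * x‖ ≤ 1 := by
      rw [norm_prime_zpow_mul, zpow_neg]
      exact inv_mul_le_one_of_le₀ hx (by positivity)
    set y : ℤ_[p] := ⟨_, hy⟩ with hydef
    refine ⟨⟨y.zmodRepr, y.zmodRepr_lt_p⟩, ?_⟩
    have h1 : ‖(y : ℚ_[p]) - (y.zmodRepr : ℕ)‖ < (p : ℝ) ^ (0 : ℤ) := by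
      simpa [PadicInt.norm_def] using y.norm_sub_zmodRepr_lt_one
    rw [Padic.norm_lt_pow_iff_norm_le_pow_sub_one] at h1
    have h2 : x - (p : ℚ_[p]) ^ (-(k + 1)) * (y.zmodRepr : ℕ) =
        (p : ℚ_[p]) ^ (-(k + 1)) * ((y : ℚ_[p]) - (y.zmodRepr : ℕ)) := by
      rw [mul_sub, hydef, ← mul_assoc, ← zpow_add₀ hp']
      simp
    rw [h2, norm_prime_zpow_mul, neg_neg]
    calc (p : ℝ) ^ (k + 1) * _ ≤ (p : ℝ) ^ (k + 1) * (p : ℝ) ^ (0 - 1 : ℤ) := by gcongr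
      _ = (p : ℝ) ^ k := by rw [← zpow_add₀ hp.ne']; congr 1; ring
  · rintro ⟨i, hi⟩
    have h1 : ‖(p : ℚ_[p]) ^ (-(k + 1)) * (i : ℕ)‖ ≤ (p : ℝ) ^ (k + 1) := by
      rw [norm_prime_zpow_mul, neg_neg]
      exact mul_le_of_le_one_right (by positivity) (by simpa using Padic.norm_int_le_one (p := p) i)
    have h2 : (p : ℝ) ^ k ≤ (p : ℝ) ^ (k + 1) :=
      zpow_le_zpow_right₀ one_lt_cast_prime.le (by lia)
    simpa using (Padic.nonarchimedean (x - (p : ℚ_[p]) ^ (-(k + 1)) * ((i : ℕ) : ℚ_[p]))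
      ((p : ℚ_[p]) ^ (-(k + 1)) * ((i : ℕ) : ℚ_[p]))).trans
      (max_le (hi.trans h2) h1)

lemma pairwise_disjoint_closedBall_zpow (k : ℤ) :
    Pairwise (Function.onFun Disjoint fun i : Fin p =>
      Metric.closedBall ((p : ℚ_[p]) ^ (-(k + 1)) * (i : ℕ)) ((p : ℝ) ^ k)) := by
  intro i j hij
  have hp : (0 : ℝ) < p := cast_prime_pos
  refine (IsUltrametricDist.closedBall_eq_or_disjoint _ _ _).resolve_left fun h => hij ?_
  have hmem : (p : ℚ_[p]) ^ (-(k + 1)) * (i : ℕ) ∈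
      Metric.closedBall ((p : ℚ_[p]) ^ (-(k + 1)) * (j : ℕ)) ((p : ℝ) ^ k) :=
    h ▸ Metric.mem_closedBall_self (by positivity)
  rw [Metric.mem_closedBall, dist_eq_norm, ← mul_sub, norm_prime_zpow_mul, neg_neg,
    zpow_add_one₀ hp.ne', mul_assoc] at hmem
  have h1 : (p : ℝ) * ‖((i : ℕ) : ℚ_[p]) - (j : ℕ)‖ ≤ 1 :=
    le_of_mul_le_mul_left (by simpa using hmem) (zpow_pos hp k)
  have h2 : ‖(((i : ℕ) - (j : ℕ) : ℤ) : ℚ_[p])‖ < 1 := by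
    push_cast
    have := one_lt_cast_prime (p := p)
    nlinarith [norm_nonneg (((i : ℕ) : ℚ_[p]) - (j : ℕ))]
  rw [Padic.norm_intCast_lt_one_iff] at h2
  have h3 := Int.eq_zero_of_abs_lt_dvd h2 (by rw [abs_lt]; have := i.2; have := j.2; omega)
  exact Fin.ext (by lia)

lemma closedBall_zpow_union_sphere (k : ℤ) :
    Metric.closedBall (0 : ℚ_[p]) ((p : ℝ) ^ k) ∪ Metric.sphere 0 ((p : ℝ) ^ (k + 1)) =
      Metric.closedBall 0 ((p : ℝ) ^ (k + 1)) := by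
  ext x
  have h := Padic.norm_le_pow_iff_norm_lt_pow_add_one x k
  simp only [Set.mem_union, Metric.mem_closedBall, mem_sphere_iff_norm, dist_zero_right, sub_zero,
    h]
  exact le_iff_lt_or_eq.symm

lemma disjoint_closedBall_zpow_sphere (k : ℤ) :
    Disjoint (Metric.closedBall (0 : ℚ_[p]) ((p : ℝ) ^ k))
      (Metric.sphere 0 ((p : ℝ) ^ (k + 1))) := by
  rw [Set.disjoint_left]
  intro x hx hx'
  rw [mem_closedBall_zero_iff, Padic.norm_le_pow_iff_norm_lt_pow_add_one] at hx
  exact hx.ne (mem_sphere_zero_iff_norm.1 hx')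

lemma closedBall_zpow_sdiff_zero_subset (k : ℤ) :
    Metric.closedBall (0 : ℚ_[p]) ((p : ℝ) ^ k) \ {0} ⊆
      ⋃ n : ℕ, Metric.sphere 0 ((p : ℝ) ^ (k - (n : ℤ))) := by
  rintro x ⟨hx, hx0⟩
  obtain ⟨m, hm⟩ : ∃ m : ℤ, ‖x‖ = (p : ℝ) ^ (-m) := ⟨_, Padic.norm_eq_zpow_neg_valuation hx0⟩
  rw [mem_closedBall_zero_iff, hm, zpow_le_zpow_iff_right₀ one_lt_cast_prime] at hx
  refine Set.mem_iUnion.2 ⟨(k - -m).toNat, mem_sphere_zero_iff_norm.2 ?_⟩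
  rw [hm]
  congr 1
  lia

end Balls

section Measure

variable {p : ℕ} [Fact p.Prime] [MeasurableSpace ℚ_[p]] [BorelSpace ℚ_[p]]
  {μ : Measure ℚ_[p]} [μ.IsAddHaarMeasure]

lemma measureReal_closedBall_zpow_add_one (k : ℤ) :
    μ.real (Metric.closedBall 0 ((p : ℝ) ^ (k + 1))) =
      p * μ.real (Metric.closedBall 0 ((p : ℝ) ^ k)) := by
  rw [closedBall_zpow_eq_iUnion, measureReal_iUnion_fintype (pairwise_disjoint_closedBall_zpow k)
    (fun _ => measurableSet_closedBall) (fun _ => (isCompact_closedBall _ _).measure_ne_top)]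
  simp [measureReal_def, Measure.addHaar_closedBall_center]

lemma measureReal_closedBall_zpow (hμ : μ {x : ℚ_[p] | ‖x‖ ≤ 1} = 1) (k : ℤ) :
    μ.real (Metric.closedBall 0 ((p : ℝ) ^ k)) = (p : ℝ) ^ k := by
  have hp : (p : ℝ) ≠ 0 := cast_prime_pos.ne'
  induction k with
  | zero => simp [measureReal_def, Metric.closedBall, hμ]
  | succ n ih => rw [measureReal_closedBall_zpow_add_one, ih, zpow_add_one₀ hp, mul_comm]
  | pred n ih =>
    have h := measureReal_closedBall_zpow_add_one (μ := μ) (-(n : ℤ) - 1)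
    rw [sub_add_cancel, ih] at h
    apply mul_left_cancel₀ hp
    rw [← h, zpow_sub_one₀ hp]
    field_simp

lemma measureReal_sphere_zpow (hμ : μ {x : ℚ_[p] | ‖x‖ ≤ 1} = 1) (k : ℤ) :
    μ.real (Metric.sphere 0 ((p : ℝ) ^ (k + 1))) = ((p : ℝ) - 1) * (p : ℝ) ^ k := by
  have h := measureReal_union (μ := μ) (disjoint_closedBall_zpow_sphere (p := p) k)
    Metric.isClosed_sphere.measurableSet
    (isCompact_closedBall _ _).measure_ne_top (isCompact_sphere _ _).measure_ne_top
  rw [closedBall_zpow_union_sphere, measureReal_closedBall_zpow hμ,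
    measureReal_closedBall_zpow hμ] at h
  linarith [zpow_add_one₀ (cast_prime_pos (p := p)).ne' k]

variable {φ : ℚ_[p] → ℂ} {ψ : ℤ → ℂ}

lemma integrableOn_sphere (hψ : ∀ (x : ℚ_[p]) (k : ℤ), ‖x‖ = (p : ℝ) ^ k → φ x = ψ k) (k : ℤ) :
    IntegrableOn φ (Metric.sphere 0 ((p : ℝ) ^ k)) μ :=
  (integrableOn_const (C := ψ k) (isCompact_sphere _ _).measure_ne_top).congr_fun
    (fun x hx => (hψ x k (mem_sphere_zero_iff_norm.1 hx)).symm)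
    Metric.isClosed_sphere.measurableSet

lemma setIntegral_sphere (hμ : μ {x : ℚ_[p] | ‖x‖ ≤ 1} = 1)
    (hψ : ∀ (x : ℚ_[p]) (k : ℤ), ‖x‖ = (p : ℝ) ^ k → φ x = ψ k) (k : ℤ) :
    ∫ x in Metric.sphere 0 ((p : ℝ) ^ (k + 1)), φ x ∂μ =
      ((p : ℂ) - 1) * (p : ℂ) ^ k * ψ (k + 1) := by
  rw [setIntegral_congr_fun (g := fun _ => ψ (k + 1)) Metric.isClosed_sphere.measurableSet
    (fun x hx => hψ x _ (mem_sphere_zero_iff_norm.1 hx)), setIntegral_const,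
    measureReal_sphere_zpow hμ, Complex.real_smul]
  push_cast
  rfl

lemma integrableOn_closedBall (hμ : μ {x : ℚ_[p] | ‖x‖ ≤ 1} = 1)
    (hψ : ∀ (x : ℚ_[p]) (k : ℤ), ‖x‖ = (p : ℝ) ^ k → φ x = ψ k) (k : ℤ)
    (hint : Summable (fun n : ℕ => (p : ℝ) ^ (k - (n : ℤ)) * ‖ψ (k - (n : ℤ))‖)) :
    IntegrableOn φ (Metric.closedBall 0 ((p : ℝ) ^ k)) μ := by
  have hp : (p : ℝ) ≠ 0 := cast_prime_pos.ne'
  have h : IntegrableOn φ (⋃ n : ℕ, Metric.sphere 0 ((p : ℝ) ^ (k - (n : ℤ)))) μ := by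
    refine integrableOn_iUnion_of_summable_integral_norm
      (fun n => integrableOn_sphere hψ _) ?_
    refine (hint.mul_left (((p : ℝ) - 1) * (p : ℝ)⁻¹)).congr fun n => ?_
    rw [setIntegral_congr_fun (g := fun _ => ‖ψ (k - (n : ℤ))‖)
      Metric.isClosed_sphere.measurableSet
      (fun x hx => congrArg _ (hψ x _ (mem_sphere_zero_iff_norm.1 hx))), setIntegral_const]
    have h := measureReal_sphere_zpow hμ (k - n - 1)
    rw [sub_add_cancel, zpow_sub_one₀ hp] at h
    rw [h, smul_eq_mul]
    ring
  refine (h.mono_set (closedBall_zpow_sdiff_zero_subset k)).congr_set_ae ?_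
  exact (sdiff_null_ae_eq_self (measure_singleton 0)).symm

lemma laplace_prime_zpow (hμ : μ {x : ℚ_[p] | ‖x‖ ≤ 1} = 1)
    (hψ : ∀ (x : ℚ_[p]) (k : ℤ), ‖x‖ = (p : ℝ) ^ k → φ x = ψ k) (k : ℤ)
    (hint : Summable (fun n : ℕ => (p : ℝ) ^ (k - (n : ℤ)) * ‖ψ (k - (n : ℤ))‖)) :
    laplace p μ φ ((p : ℚ_[p]) ^ k) =
      ∫ x in Metric.closedBall 0 ((p : ℝ) ^ k), φ x ∂μ - (p : ℂ) ^ k * ψ (k + 1) := by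
  have hp : (0 : ℝ) < p := cast_prime_pos
  have hp1 : (p : ℂ) - 1 ≠ 0 := by
    rw [sub_ne_zero]
    exact_mod_cast (Fact.out : p.Prime).ne_one
  have hv : ∀ x : ℚ_[p], v0 p (x * (p : ℚ_[p]) ^ k) * φ x =
      (Metric.closedBall 0 ((p : ℝ) ^ k)).indicator φ x +
      (Metric.sphere 0 ((p : ℝ) ^ (k + 1))).indicator
        (fun x => -1 / ((p : ℂ) - 1) * φ x) x := by
    intro x
    have h1 : ‖x * (p : ℚ_[p]) ^ k‖ ≤ 1 ↔ x ∈ Metric.closedBall 0 ((p : ℝ) ^ k) := by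
      rw [mul_comm, norm_prime_zpow_mul, zpow_neg, mem_closedBall_zero_iff,
        inv_mul_le_iff₀ (zpow_pos hp k), mul_one]
    have h2 : ‖x * (p : ℚ_[p]) ^ k‖ = p ↔ x ∈ Metric.sphere 0 ((p : ℝ) ^ (k + 1)) := by
      rw [mul_comm, norm_prime_zpow_mul, zpow_neg, mem_sphere_zero_iff_norm,
        inv_mul_eq_iff_eq_mul₀ (zpow_pos hp k).ne', zpow_add_one₀ hp.ne']
    rw [v0]
    by_cases hb : x ∈ Metric.closedBall 0 ((p : ℝ) ^ k)
    · have hs := Set.disjoint_left.1 (disjoint_closedBall_zpow_sphere k) hb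
      rw [if_pos (h1.2 hb), Set.indicator_of_mem hb, Set.indicator_of_notMem hs, one_mul, add_zero]
    · rw [if_neg (mt h1.1 hb), Set.indicator_of_notMem hb, zero_add]
      by_cases hs : x ∈ Metric.sphere 0 ((p : ℝ) ^ (k + 1))
      · rw [if_pos (h2.2 hs), Set.indicator_of_mem hs]
      · rw [if_neg (mt h2.1 hs), Set.indicator_of_notMem hs, zero_mul]
  have hS : MeasurableSet (Metric.sphere (0 : ℚ_[p]) ((p : ℝ) ^ (k + 1))) :=
    Metric.isClosed_sphere.measurableSet
  rw [laplace, integral_congr_ae (Filter.Eventually.of_forall hv)]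
  rw [integral_add ((integrableOn_closedBall hμ hψ k hint).integrable_indicator
      measurableSet_closedBall)
    (IntegrableOn.integrable_indicator ((integrableOn_sphere hψ (k + 1)).const_mul _) hS),
    integral_indicator measurableSet_closedBall, integral_indicator hS, integral_const_mul,
    setIntegral_sphere hμ hψ]
  field_simp
  ring

lemma setIntegral_closedBall_zpow_add_one (hμ : μ {x : ℚ_[p] | ‖x‖ ≤ 1} = 1)
    (hψ : ∀ (x : ℚ_[p]) (k : ℤ), ‖x‖ = (p : ℝ) ^ k → φ x = ψ k) (k : ℤ)
    (hint : Summable (fun n : ℕ => (p : ℝ) ^ (k - (n : ℤ)) * ‖ψ (k - (n : ℤ))‖)) :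
    ∫ x in Metric.closedBall 0 ((p : ℝ) ^ (k + 1)), φ x ∂μ =
      ∫ x in Metric.closedBall 0 ((p : ℝ) ^ k), φ x ∂μ +
        ((p : ℂ) - 1) * (p : ℂ) ^ k * ψ (k + 1) := by
  rw [← closedBall_zpow_union_sphere, setIntegral_union (disjoint_closedBall_zpow_sphere k)
    Metric.isClosed_sphere.measurableSet (integrableOn_closedBall hμ hψ k hint)
    (integrableOn_sphere hψ (k + 1)), setIntegral_sphere hμ hψ]

end Measure

end PadicLaplace

/-- Uniqueness theorem for the Laplace-type transform: if `φ̃(ξ) = 0` for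
all `ξ ≠ 0`, then `φ` is constant, i.e. `ψ(k) = ψ(0)` for all `k ∈ ℤ`. -/
theorem statement15
    (μ : Measure ℚ_[p]) [μ.IsAddHaarMeasure]
    (hμ : μ {x : ℚ_[p] | ‖x‖ ≤ 1} = 1)
    (φ : ℚ_[p] → ℂ) (ψ : ℤ → ℂ)
    (hψ : ∀ (x : ℚ_[p]) (k : ℤ), ‖x‖ = (p : ℝ) ^ k → φ x = ψ k)
    (hint : ∀ K : ℤ, Summable (fun n : ℕ => (p : ℝ) ^ (K - (n : ℤ)) * ‖ψ (K - (n : ℤ))‖))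
    (h0 : ∀ ξ : ℚ_[p], ξ ≠ 0 → laplace p μ φ ξ = 0) :
    ∀ k : ℤ, ψ k = ψ 0 := by
  have hp : (p : ℂ) ≠ 0 := by exact_mod_cast (Fact.out : p.Prime).ne_zero
  have hp' : (p : ℚ_[p]) ≠ 0 := by exact_mod_cast (Fact.out : p.Prime).ne_zero
  have hball (k : ℤ) :
      ∫ x in Metric.closedBall 0 ((p : ℝ) ^ k), φ x ∂μ = (p : ℂ) ^ k * ψ (k + 1) := by
    have h := PadicLaplace.laplace_prime_zpow hμ hψ k (hint k)
    rw [h0 _ (zpow_ne_zero k hp')] at h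
    exact (sub_eq_zero.1 h.symm)
  have hstep (k : ℤ) : ψ (k + 1) = ψ k := by
    obtain ⟨m, rfl⟩ : ∃ m, k = m + 1 := ⟨k - 1, by ring⟩
    have h := PadicLaplace.setIntegral_closedBall_zpow_add_one hμ hψ m (hint m)
    rw [hball, hball, zpow_add_one₀ hp] at h
    refine mul_left_cancel₀ (mul_ne_zero (zpow_ne_zero m hp) hp) ?_
    linear_combination h
  intro k
  induction k with
  | zero => rfl
  | succ n ih => rw [hstep, ih]
  | pred n ih => rw [← hstep, sub_add_cancel, ih]
end
end

section
/- A radial function is (strictly) monotone if and only if its Laplace-type transform is (strictly) monotone: for real-valued φ, the sequence k ↦ ψ(k) is strictly increasing (respectively, strictly decreasing, increasing, decreasing) on ℤ if and only if the sequence n ↦ Φ(n) is strictly increasing (respectively, strictly decreasing, increasing, decreasing) on ℤ. -/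
open MeasureTheory Complex

noncomputable section

variable (p : ℕ) [Fact p.Prime] [MeasurableSpace ℚ_[p]] [BorelSpace ℚ_[p]]

/-- The real-valued radial function `v_0`: equal to `1` for `‖z‖ ≤ 1`, to `−1/(p−1)` for
`‖z‖ = p`, and to `0` for `‖z‖ ≥ p²`. -/
def v0R (z : ℚ_[p]) : ℝ :=
  if ‖z‖ ≤ 1 then 1
  else if ‖z‖ = (p : ℝ) then -1 / ((p : ℝ) - 1)
  else 0

/-- `Φ(n)`: the value of the (real-valued) Laplace-type transform
`φ̃(ξ) = ∫ v_0(xξ) φ(x) dμ(x)` at any `ξ` with `‖ξ‖ = pⁿ` (taken at `ξ = p^{-n}`). -/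
def PhiR (μ : Measure ℚ_[p]) (φ : ℚ_[p] → ℝ) (n : ℤ) : ℝ :=
  ∫ x, v0R p (x * (p : ℚ_[p]) ^ (-n)) * φ x ∂μ

open Metric

set_option linter.unusedSectionVars false

namespace Padic

variable {p}

lemma closedBall_zpow_succ_eq_iUnion (k : ℤ) :
    closedBall (0 : ℚ_[p]) ((p : ℝ) ^ (k + 1)) =
      ⋃ i : Fin p, closedBall ((i : ℕ) * (p : ℚ_[p]) ^ (-(k + 1))) ((p : ℝ) ^ k) := by
  have hp : (0 : ℝ) < p := mod_cast (Fact.out : p.Prime).pos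
  have hpK : (p : ℚ_[p]) ≠ 0 := mod_cast (Fact.out : p.Prime).ne_zero
  have scale (y : ℚ_[p]) : ‖y * (p : ℚ_[p]) ^ (-(k + 1))‖ = ‖y‖ * (p : ℝ) ^ (k + 1) := by
    rw [norm_mul, norm_p_zpow, neg_neg]
  have hball (y : ℚ_[p]) : ‖y‖ * (p : ℝ) ^ (k + 1) ≤ (p : ℝ) ^ k ↔ ‖y‖ < 1 := by
    have := norm_lt_pow_iff_norm_le_pow_sub_one y 0
    rw [zpow_zero] at this
    rw [this, ← le_div_iff₀ (zpow_pos hp _), ← zpow_sub₀ hp.ne']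
    simp
  ext x
  obtain ⟨y, rfl⟩ : ∃ y, x = y * (p : ℚ_[p]) ^ (-(k + 1)) :=
    ⟨x * (p : ℚ_[p]) ^ (k + 1), by
      rw [mul_assoc, ← zpow_add₀ hpK, add_neg_cancel, zpow_zero, mul_one]⟩
  simp only [mem_closedBall, dist_eq_norm, sub_zero, Set.mem_iUnion, ← sub_mul, scale, hball]
  rw [mul_le_iff_le_one_left (zpow_pos hp _)]
  constructor
  · intro hy
    obtain ⟨i, hi, h⟩ := PadicInt.exists_mem_range (⟨y, hy⟩ : ℤ_[p])
    refine ⟨⟨i, hi⟩, ?_⟩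
    rw [IsLocalRing.mem_maximalIdeal, PadicInt.mem_nonunits, PadicInt.norm_def] at h
    exact h
  · rintro ⟨i, hi⟩
    have := nonarchimedean (y - ((i : ℕ) : ℚ_[p])) ((i : ℕ) : ℚ_[p])
    rw [sub_add_cancel] at this
    exact this.trans (max_le hi.le (mod_cast norm_int_le_one ((i : ℕ) : ℤ)))

lemma pairwise_disjoint_closedBall_zpow (k : ℤ) :
    Pairwise (Function.onFun Disjoint fun i : Fin p ↦
      closedBall ((i : ℕ) * (p : ℚ_[p]) ^ (-(k + 1))) ((p : ℝ) ^ k)) := by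
  have hp : (0 : ℝ) < p := mod_cast (Fact.out : p.Prime).pos
  intro i j hij
  refine (IsUltrametricDist.closedBall_eq_or_disjoint _ _ _).resolve_left fun h ↦ hij ?_
  have hmem := h ▸ mem_closedBall_self (zpow_pos hp k).le
  rw [mem_closedBall, dist_eq_norm, ← sub_mul, norm_mul, norm_p_zpow, neg_neg,
    ← le_div_iff₀ (zpow_pos hp _), ← zpow_sub₀ hp.ne'] at hmem
  have hlt : ‖(((i : ℕ) - (j : ℕ) : ℤ) : ℚ_[p])‖ < 1 := by
    have := (norm_lt_pow_iff_norm_le_pow_sub_one (((i : ℕ) - (j : ℕ) : ℤ) : ℚ_[p]) 0).2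
      (by push_cast; simpa using hmem)
    simpa using this
  rw [norm_intCast_lt_one_iff] at hlt
  have := Int.eq_zero_of_abs_lt_dvd hlt (by rw [abs_lt]; omega)
  omega

lemma exists_norm_eq_zpow {x : ℚ_[p]} (hx : x ≠ 0) : ∃ k : ℤ, ‖x‖ = (p : ℝ) ^ k :=
  ⟨_, norm_eq_zpow_neg_valuation hx⟩

lemma closedBall_zpow_eq_union_sphere (k : ℤ) :
    closedBall (0 : ℚ_[p]) ((p : ℝ) ^ k) =
      closedBall 0 ((p : ℝ) ^ (k - 1)) ∪ sphere 0 ((p : ℝ) ^ k) := by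
  ext x
  have := norm_lt_pow_iff_norm_le_pow_sub_one x k
  simp only [mem_closedBall, dist_zero_right, Set.mem_union, mem_sphere, ← this]
  exact le_iff_lt_or_eq

lemma disjoint_closedBall_sphere_zpow (k : ℤ) :
    Disjoint (closedBall (0 : ℚ_[p]) ((p : ℝ) ^ (k - 1))) (sphere 0 ((p : ℝ) ^ k)) := by
  rw [Set.disjoint_left]
  intro x hx hx'
  rw [mem_closedBall, dist_zero_right, ← norm_lt_pow_iff_norm_le_pow_sub_one] at hx
  rw [mem_sphere, dist_zero_right] at hx'
  exact hx.ne hx'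

lemma closedBall_zpow_eq_iUnion_sphere (k : ℤ) :
    closedBall (0 : ℚ_[p]) ((p : ℝ) ^ k) =
      {0} ∪ ⋃ n : ℕ, sphere 0 ((p : ℝ) ^ (k - (n : ℤ))) := by
  have hp : (1 : ℝ) < p := mod_cast (Fact.out : p.Prime).one_lt
  ext x
  simp only [mem_closedBall, dist_zero_right, Set.mem_union, mem_sphere, Set.mem_iUnion,
    Set.mem_singleton_iff]
  constructor
  · intro hx
    refine or_iff_not_imp_left.2 fun hx0 ↦ ?_
    obtain ⟨m, hm⟩ := exists_norm_eq_zpow hx0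
    rw [hm, zpow_le_zpow_iff_right₀ hp] at hx
    exact ⟨(k - m).toNat, by rw [hm]; congr 1; omega⟩
  · rintro (rfl | ⟨n, hn⟩)
    · rw [norm_zero]; positivity
    · rw [hn, zpow_le_zpow_iff_right₀ hp]; omega

variable (μ : Measure ℚ_[p]) [μ.IsAddHaarMeasure]

lemma measureReal_closedBall_zpow_succ (k : ℤ) :
    μ.real (closedBall 0 ((p : ℝ) ^ (k + 1))) = p * μ.real (closedBall 0 ((p : ℝ) ^ k)) := by
  rw [closedBall_zpow_succ_eq_iUnion, measureReal_def,
    measure_iUnion (pairwise_disjoint_closedBall_zpow k) fun _ ↦ measurableSet_closedBall]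
  simp [Measure.addHaar_closedBall_center, measureReal_def]

variable {μ}

lemma measureReal_closedBall_zpow (hμ : μ {x : ℚ_[p] | ‖x‖ ≤ 1} = 1) (k : ℤ) :
    μ.real (closedBall 0 ((p : ℝ) ^ k)) = (p : ℝ) ^ k := by
  have hp : (p : ℝ) ≠ 0 := mod_cast (Fact.out : p.Prime).ne_zero
  induction k with
  | zero => simp [measureReal_def, closedBall, hμ]
  | succ k ih => rw [measureReal_closedBall_zpow_succ, ih, zpow_add_one₀ hp, mul_comm]
  | pred k ih =>
    have := measureReal_closedBall_zpow_succ μ (-(k : ℤ) - 1)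
    rw [sub_add_cancel, ih] at this
    refine mul_left_cancel₀ hp (this.symm.trans ?_)
    rw [← zpow_one_add₀ hp, add_sub_cancel]

lemma measureReal_sphere_zpow (hμ : μ {x : ℚ_[p] | ‖x‖ ≤ 1} = 1) (k : ℤ) :
    μ.real (sphere 0 ((p : ℝ) ^ k)) = (p : ℝ) ^ k * (1 - (p : ℝ)⁻¹) := by
  have hp : (p : ℝ) ≠ 0 := mod_cast (Fact.out : p.Prime).ne_zero
  have h := measureReal_closedBall_zpow hμ k
  rw [closedBall_zpow_eq_union_sphere, measureReal_union (disjoint_closedBall_sphere_zpow k)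
    isClosed_sphere.measurableSet measure_closedBall_lt_top.ne
    ((isCompact_sphere _ _).measure_lt_top.ne), measureReal_closedBall_zpow hμ,
    zpow_sub_one₀ hp] at h
  linear_combination h

variable {φ : ℚ_[p] → ℝ} {ψ : ℤ → ℝ}

lemma radial_eqOn_sphere
    (hψ : ∀ (x : ℚ_[p]) (k : ℤ), ‖x‖ = (p : ℝ) ^ k → φ x = ψ k)
    (k : ℤ) :
    Set.EqOn φ (fun _ ↦ ψ k) (sphere 0 ((p : ℝ) ^ k)) :=
  fun x hx ↦ hψ x k (by simpa using hx)

lemma integrableOn_radial_sphere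
    (hψ : ∀ (x : ℚ_[p]) (k : ℤ), ‖x‖ = (p : ℝ) ^ k → φ x = ψ k)
    (k : ℤ) : IntegrableOn φ (sphere 0 ((p : ℝ) ^ k)) μ :=
  (integrableOn_const (isCompact_sphere _ _).measure_lt_top.ne).congr_fun
    (radial_eqOn_sphere hψ k).symm isClosed_sphere.measurableSet

lemma setIntegral_radial_sphere
    (hψ : ∀ (x : ℚ_[p]) (k : ℤ), ‖x‖ = (p : ℝ) ^ k → φ x = ψ k)
    (hμ : μ {x : ℚ_[p] | ‖x‖ ≤ 1} = 1) (k : ℤ) :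
    ∫ x in sphere 0 ((p : ℝ) ^ k), φ x ∂μ = (p : ℝ) ^ k * (1 - (p : ℝ)⁻¹) * ψ k := by
  rw [setIntegral_congr_fun isClosed_sphere.measurableSet (radial_eqOn_sphere hψ k),
    setIntegral_const, measureReal_sphere_zpow hμ, smul_eq_mul]

lemma integrableOn_radial_closedBall
    (hψ : ∀ (x : ℚ_[p]) (k : ℤ), ‖x‖ = (p : ℝ) ^ k → φ x = ψ k)
    (hμ : μ {x : ℚ_[p] | ‖x‖ ≤ 1} = 1) (k : ℤ)
    (hint : Summable fun n : ℕ ↦ (p : ℝ) ^ (k - (n : ℤ)) * |ψ (k - (n : ℤ))|) :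
    IntegrableOn φ (closedBall 0 ((p : ℝ) ^ k)) μ := by
  rw [closedBall_zpow_eq_iUnion_sphere]
  refine (integrableOn_singleton (hx := isCompact_singleton.measure_lt_top)).union
    (integrableOn_iUnion_of_summable_integral_norm
      (fun n ↦ integrableOn_radial_sphere hψ _) ?_)
  refine (hint.mul_right (1 - (p : ℝ)⁻¹)).congr fun n ↦ ?_
  rw [setIntegral_radial_sphere (φ := fun x ↦ ‖φ x‖) (ψ := fun k ↦ |ψ k|)
    (fun x k hx ↦ by rw [hψ x k hx, Real.norm_eq_abs]) hμ]
  ring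

end Padic

lemma v0R_mul_zpow (x : ℚ_[p]) (n : ℤ) :
    v0R p (x * (p : ℚ_[p]) ^ (-n)) =
      (closedBall 0 ((p : ℝ) ^ (-n))).indicator 1 x -
        1 / ((p : ℝ) - 1) * (sphere 0 ((p : ℝ) ^ (1 - n))).indicator 1 x := by
  have hp : (1 : ℝ) < p := mod_cast (Fact.out : p.Prime).one_lt
  have hp0 : (0 : ℝ) < p := by linarith
  have hnorm : ‖x * (p : ℚ_[p]) ^ (-n)‖ = ‖x‖ * (p : ℝ) ^ n := by
    rw [norm_mul, Padic.norm_p_zpow, neg_neg]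
  have hle : x ∈ closedBall 0 ((p : ℝ) ^ (-n)) ↔ ‖x * (p : ℚ_[p]) ^ (-n)‖ ≤ 1 := by
    rw [hnorm, ← le_div_iff₀ (zpow_pos hp0 _), one_div, ← zpow_neg, mem_closedBall,
      dist_zero_right]
  have heq : x ∈ sphere 0 ((p : ℝ) ^ (1 - n)) ↔ ‖x * (p : ℚ_[p]) ^ (-n)‖ = p := by
    rw [hnorm, ← eq_div_iff (zpow_pos hp0 _).ne', zpow_sub₀ hp0.ne', zpow_one, mem_sphere,
      dist_zero_right]
  classical
  simp only [v0R, Set.indicator_apply, hle, heq, Pi.one_apply]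
  split_ifs <;> first | linarith | ring

section Transform

variable {p} {μ : Measure ℚ_[p]} [μ.IsAddHaarMeasure] {φ : ℚ_[p] → ℝ} {ψ : ℤ → ℝ}

lemma PhiR_eq_sub (hμ : μ {x : ℚ_[p] | ‖x‖ ≤ 1} = 1)
    (hψ : ∀ (x : ℚ_[p]) (k : ℤ), ‖x‖ = (p : ℝ) ^ k → φ x = ψ k) (n : ℤ)
    (hφ : IntegrableOn φ (closedBall 0 ((p : ℝ) ^ (-n))) μ) :
    PhiR p μ φ n =
      ∫ x in closedBall 0 ((p : ℝ) ^ (-n)), φ x ∂μ - (p : ℝ) ^ (-n) * ψ (1 - n) := by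
  have hp : (1 : ℝ) < p := mod_cast (Fact.out : p.Prime).one_lt
  have hp0 : (p : ℝ) ≠ 0 := by linarith
  have hp1 : (p : ℝ) - 1 ≠ 0 := by linarith
  have key (x : ℚ_[p]) : v0R p (x * (p : ℚ_[p]) ^ (-n)) * φ x =
      (closedBall 0 ((p : ℝ) ^ (-n))).indicator φ x -
        1 / ((p : ℝ) - 1) * (sphere 0 ((p : ℝ) ^ (1 - n))).indicator φ x := by
    rw [v0R_mul_zpow, sub_mul, mul_assoc, ← Set.indicator_mul_left, ← Set.indicator_mul_left]
    simp
  simp only [PhiR, key]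
  rw [integral_sub (hφ.integrable_indicator measurableSet_closedBall)
    (((Padic.integrableOn_radial_sphere hψ _).integrable_indicator
      isClosed_sphere.measurableSet).const_mul _), integral_const_mul,
    integral_indicator measurableSet_closedBall,
    integral_indicator isClosed_sphere.measurableSet, Padic.setIntegral_radial_sphere hψ hμ,
    show 1 - n = -n + 1 by ring, zpow_add_one₀ hp0]
  field_simp

lemma PhiR_succ_sub (hμ : μ {x : ℚ_[p] | ‖x‖ ≤ 1} = 1)
    (hψ : ∀ (x : ℚ_[p]) (k : ℤ), ‖x‖ = (p : ℝ) ^ k → φ x = ψ k)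
    (hφ : ∀ k : ℤ, IntegrableOn φ (closedBall 0 ((p : ℝ) ^ k)) μ) (n : ℤ) :
    PhiR p μ φ (n + 1) - PhiR p μ φ n = (p : ℝ) ^ (-n) * (ψ (-n + 1) - ψ (-n)) := by
  have hp0 : (p : ℝ) ≠ 0 := mod_cast (Fact.out : p.Prime).ne_zero
  rw [PhiR_eq_sub hμ hψ _ (hφ _), PhiR_eq_sub hμ hψ _ (hφ _),
    Padic.closedBall_zpow_eq_union_sphere (-n),
    setIntegral_union (Padic.disjoint_closedBall_sphere_zpow _) isClosed_sphere.measurableSet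
      (hφ _) (Padic.integrableOn_radial_sphere hψ _), Padic.setIntegral_radial_sphere hψ hμ,
    show -(n + 1) = -n - 1 by ring, show 1 - (n + 1) = -n by ring,
    show 1 - n = -n + 1 by ring, zpow_sub_one₀ hp0]
  ring

end Transform

lemma monotone_int_iff_le_succ {f : ℤ → ℝ} : Monotone f ↔ ∀ n, f n ≤ f (n + 1) :=
  ⟨fun h n ↦ h (by omega), monotone_int_of_le_succ⟩

lemma strictMono_int_iff_lt_succ {f : ℤ → ℝ} : StrictMono f ↔ ∀ n, f n < f (n + 1) :=
  ⟨fun h n ↦ h (by omega), strictMono_int_of_lt_succ⟩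

lemma strictMono_int_iff_of_succ_sub {f g c : ℤ → ℝ} (hc : ∀ n, 0 < c n)
    (h : ∀ n, g (n + 1) - g n = c n * (f (-n + 1) - f (-n))) :
    StrictMono f ↔ StrictMono g := by
  rw [strictMono_int_iff_lt_succ, strictMono_int_iff_lt_succ, ← (Equiv.neg ℤ).forall_congr_right]
  refine forall_congr' fun n ↦ ?_
  rw [← sub_pos (b := g n), h, mul_pos_iff_of_pos_left (hc n), sub_pos, Equiv.neg_apply]

lemma monotone_int_iff_of_succ_sub {f g c : ℤ → ℝ} (hc : ∀ n, 0 < c n)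
    (h : ∀ n, g (n + 1) - g n = c n * (f (-n + 1) - f (-n))) :
    Monotone f ↔ Monotone g := by
  rw [monotone_int_iff_le_succ, monotone_int_iff_le_succ, ← (Equiv.neg ℤ).forall_congr_right]
  refine forall_congr' fun n ↦ ?_
  rw [← sub_nonneg (b := g n), h, mul_nonneg_iff_of_pos_left (hc n), sub_nonneg,
    Equiv.neg_apply]

/-- A radial function is (strictly) monotone iff its Laplace-type
transform is (strictly) monotone: `ψ` is strictly increasing (resp. strictly decreasing,
increasing, decreasing) on `ℤ` iff `Φ` is. -/
theorem statement17
    (μ : Measure ℚ_[p]) [μ.IsAddHaarMeasure]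
    (hμ : μ {x : ℚ_[p] | ‖x‖ ≤ 1} = 1)
    (φ : ℚ_[p] → ℝ) (ψ : ℤ → ℝ)
    (hψ : ∀ (x : ℚ_[p]) (k : ℤ), ‖x‖ = (p : ℝ) ^ k → φ x = ψ k)
    (hint : ∀ K : ℤ, Summable (fun n : ℕ => (p : ℝ) ^ (K - (n : ℤ)) * |ψ (K - (n : ℤ))|)) :
    (StrictMono ψ ↔ StrictMono (PhiR p μ φ)) ∧
    (StrictAnti ψ ↔ StrictAnti (PhiR p μ φ)) ∧
    (Monotone ψ ↔ Monotone (PhiR p μ φ)) ∧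
    (Antitone ψ ↔ Antitone (PhiR p μ φ)) := by
  have hc (n : ℤ) : (0 : ℝ) < (p : ℝ) ^ (-n) :=
    zpow_pos (mod_cast (Fact.out : p.Prime).pos) _
  have h := PhiR_succ_sub hμ hψ fun k ↦ Padic.integrableOn_radial_closedBall hψ hμ k (hint k)
  have hneg (n : ℤ) : (-PhiR p μ φ) (n + 1) - (-PhiR p μ φ) n =
      (p : ℝ) ^ (-n) * ((-ψ) (-n + 1) - (-ψ) (-n)) := by
    simp only [Pi.neg_apply]
    linear_combination -h n
  refine ⟨strictMono_int_iff_of_succ_sub hc h, ?_, monotone_int_iff_of_succ_sub hc h, ?_⟩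
  · have := strictMono_int_iff_of_succ_sub hc hneg
    exact ⟨fun h ↦ by simpa using (this.1 h.neg).neg, fun h ↦ by simpa using (this.2 h.neg).neg⟩
  · have := monotone_int_iff_of_succ_sub hc hneg
    exact ⟨fun h ↦ by simpa using (this.1 h.neg).neg, fun h ↦ by simpa using (this.2 h.neg).neg⟩
end
end
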